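/- arXiv:2409.00915 — 3 statements merged into one kernel-verified Lean document; each statement's English description precedes it below -/
import Mathlib

section
/- Under the block eigenvalue setup: if γ < p(s+1) + s/2, then N(d) = v_p(d) for all sufficiently large d; and if γ > p(s+1) + s/2, then N(d) = v_{p+1}(d) for all sufficiently large d. -/
open Filter

/-- `N(d,k)`, the dimension of the space of degree-`k` spherical harmonics on `S^d`:
`N(d,0) = 1` and, for `k ≥ 1`,
`N(d,k) = ((2k + d − 1)/k) · (k + d − 2)! / ((d − 1)! (k − 1)!)`. -/
noncomputable def sphDim (d k : ℕ) : ℝ :=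
  if k = 0 then 1
  else ((2 * k + d - 1 : ℝ) / k) * (Nat.factorial (k + d - 2)) /
    (Nat.factorial (d - 1) * Nat.factorial (k - 1))

/-- `v_k(d) := Σ_{k'=0}^{k} N(d,k')`. -/
noncomputable def vdim (d k : ℕ) : ℝ :=
  ∑ k' ∈ Finset.range (k + 1), sphDim d k'

/-- `v_{k-1}(d)`, with the convention `v_{−1}(d) = 0`. -/
noncomputable def vprev (d k : ℕ) : ℝ :=
  ∑ k' ∈ Finset.range k, sphDim d k'

/-- The left-hand side `(σ²/(nκ)) · Σ_{j=1}^{∞} λ_j^{-s/2}(1 − κλ_j^{-s/2})_+` of the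
Pinsker equation (the sum over `j ≥ 1` is written as a sum over `j + 1`, `j : ℕ`). -/
noncomputable def pinskerLHS (s σ : ℝ) (n : ℕ) (lam : ℕ → ℝ) (κ : ℝ) : ℝ :=
  σ ^ 2 / (n * κ) *
    ∑' j : ℕ, lam (j + 1) ^ (-(s / 2)) * max (1 - κ * lam (j + 1) ^ (-(s / 2))) 0

/-- The Pinsker weights `ℓ_j := (1 − κ* λ_j^{-s/2})_+`. -/
noncomputable def pinskerEll (s : ℝ) (lam : ℕ → ℝ) (κstar : ℝ) (j : ℕ) : ℝ :=
  max (1 - κstar * lam j ^ (-(s / 2))) 0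

/-- `N := max { j ≥ 1 : λ_j^{s/2} > κ* }`. -/
noncomputable def blockN (s : ℝ) (lam : ℕ → ℝ) (κstar : ℝ) : ℕ :=
  sSup {j : ℕ | 1 ≤ j ∧ κstar < lam j ^ (s / 2)}

/-- `D* := (σ²/n) Σ_{j=1}^{N} ℓ_j`. -/
noncomputable def pinskerD (s σ : ℝ) (n : ℕ) (lam : ℕ → ℝ) (κstar : ℝ) : ℝ :=
  σ ^ 2 / n * ∑ j ∈ Finset.Icc 1 (blockN s lam κstar), pinskerEll s lam κstar j

open Asymptotics Topology

/-- The natural number whose cast is `sphDim d k` (for `1 ≤ d`). -/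
def sphDimNat (d k : ℕ) : ℕ :=
  if k = 0 then 1 else (k + d - 2).choose (k - 1) + (k + d - 1).choose k

lemma sphDim_eq_natCast {d : ℕ} (hd : 1 ≤ d) (k : ℕ) : sphDim d k = sphDimNat d k := by
  obtain ⟨e, rfl⟩ := Nat.exists_eq_add_of_le' hd
  rcases k with _ | k
  · simp [sphDim, sphDimNat]
  · have h1 : k + 1 + (e + 1) - 2 = k + e := by omega
    have h2 : k + 1 + (e + 1) - 1 = k + e + 1 := by omega
    have h3 : ((k + e).choose k : ℝ) * (k.factorial * e.factorial) = (k + e).factorial := by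
      have := Nat.add_choose_mul_factorial_mul_factorial k e
      rw [← mul_assoc, Nat.choose_symm_add]
      exact_mod_cast this
    have h4 : ((k + e + 1).choose (k + 1) : ℝ) * (k + 1) = (k + e + 1) * (k + e).choose k := by
      exact_mod_cast (Nat.add_one_mul_choose_eq (k + e) k).symm
    have hk : (k : ℝ) + 1 ≠ 0 := by positivity
    have hf : (k.factorial : ℝ) * e.factorial ≠ 0 := by positivity
    simp only [sphDim, sphDimNat, Nat.add_eq_zero_iff, one_ne_zero, and_false, if_false, h1, h2,
      Nat.add_sub_cancel]
    push_cast
    rw [mul_comm (e.factorial : ℝ), mul_div_assoc, ← h3, mul_div_assoc, div_self hf,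
      div_mul_eq_mul_div, div_eq_iff hk]
    linear_combination -h4

lemma sphDimNat_pos {d : ℕ} (hd : 1 ≤ d) (k : ℕ) : 0 < sphDimNat d k := by
  unfold sphDimNat
  split_ifs
  · exact one_pos
  · exact Nat.add_pos_right _ (Nat.choose_pos (by omega))

lemma vprev_succ (d k : ℕ) : vprev d (k + 1) = vdim d k := rfl

lemma vprev_eq_natCast {d : ℕ} (hd : 1 ≤ d) (k : ℕ) :
    vprev d k = ((∑ i ∈ Finset.range k, sphDimNat d i : ℕ) : ℝ) := by
  simp [vprev, sphDim_eq_natCast hd]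

lemma sphDim_isTheta (k : ℕ) :
    (fun d : ℕ => sphDim d k) =Θ[atTop] fun d : ℕ => (d : ℝ) ^ (k : ℝ) := by
  simp only [Real.rpow_natCast]
  constructor
  · refine IsBigO.of_bound (2 * 2 ^ k) ?_
    filter_upwards [eventually_ge_atTop (k + 1)] with d hd
    have hd1 : 1 ≤ d := by omega
    have h : sphDimNat d k ≤ 2 * 2 ^ k * d ^ k := by
      unfold sphDimNat
      split_ifs with hk
      · simp [hk]
      · have h1 : (k + d - 2).choose (k - 1) ≤ (2 * d) ^ k :=
          (Nat.choose_le_pow _ _).trans <| (Nat.pow_le_pow_left (by omega) _).trans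
            (Nat.pow_le_pow_right (by omega) (by omega))
        have h2 : (k + d - 1).choose k ≤ (2 * d) ^ k :=
          (Nat.choose_le_pow _ _).trans (Nat.pow_le_pow_left (by omega) _)
        rw [mul_pow] at h1 h2
        linarith
    rw [sphDim_eq_natCast hd1, Real.norm_of_nonneg (by positivity),
      Real.norm_of_nonneg (by positivity)]
    exact_mod_cast h
  · refine IsBigO.of_bound k.factorial ?_
    filter_upwards [eventually_ge_atTop 1] with d hd
    rw [sphDim_eq_natCast hd, Real.norm_of_nonneg (by positivity),
      Real.norm_of_nonneg (by positivity)]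
    unfold sphDimNat
    split_ifs with hk
    · simp [hk]
    · have h := Nat.pow_le_choose (α := ℝ) k (k + d - 1)
      rw [show k + d - 1 + 1 - k = d by omega, div_le_iff₀ (by positivity)] at h
      push_cast
      nlinarith [show (0 : ℝ) ≤ k.factorial * (k + d - 2).choose (k - 1) by positivity]

lemma natCast_rpow_isLittleO {x y : ℝ} (h : x < y) :
    (fun d : ℕ => (d : ℝ) ^ x) =o[atTop] fun d : ℕ => (d : ℝ) ^ y := by
  refine (isLittleO_of_tendsto' ?_ ?_).comp_tendsto (f := fun d : ℝ => d ^ x)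
    (g := fun d : ℝ => d ^ y) tendsto_natCast_atTop_atTop
  · filter_upwards [eventually_gt_atTop 0] with d hd h0
    exact absurd h0 (Real.rpow_pos_of_pos hd y).ne'
  · refine (tendsto_rpow_neg_atTop (sub_pos.2 h)).congr' ?_
    filter_upwards [eventually_gt_atTop 0] with d hd
    rw [neg_sub, Real.rpow_sub hd]

lemma vdim_isBigO (k : ℕ) :
    (fun d : ℕ => vdim d k) =O[atTop] fun d : ℕ => (d : ℝ) ^ (k : ℝ) := by
  unfold vdim
  refine IsBigO.fun_sum fun i hi => (sphDim_isTheta i).1.trans ?_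
  rcases (Nat.le_of_lt_succ (Finset.mem_range.1 hi)).lt_or_eq with h | h
  · exact (natCast_rpow_isLittleO (by exact_mod_cast h)).isBigO
  · rw [h]; exact isBigO_refl _ _

lemma rpow_neg_isTheta {m : ℕ → ℝ} {k : ℕ} {c : ℝ} (hc : 0 < c) (s : ℝ)
    (h : Tendsto (fun d : ℕ => (d : ℝ) ^ k * m d) atTop (𝓝 c)) :
    (fun d => m d ^ (-(s / 2))) =Θ[atTop] fun d : ℕ => (d : ℝ) ^ (k * (s / 2)) := by
  refine (isTheta_of_div_tendsto_nhds_ne_zero (c := c ^ (-(s / 2))) ?_ (by positivity)).symm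
  refine (h.rpow_const (Or.inl hc.ne')).congr' ?_
  filter_upwards [h.eventually (lt_mem_nhds hc), eventually_gt_atTop 0] with d hd h0
  have h0' : (0 : ℝ) < d := by exact_mod_cast h0
  have hm : 0 < m d := pos_of_mul_pos_right hd (by positivity)
  rw [Real.mul_rpow (by positivity) hm.le, ← Real.rpow_natCast, ← Real.rpow_mul h0'.le,
    mul_neg, Real.rpow_neg h0'.le, mul_comm, ← div_eq_mul_inv]

/-- Finitely many terms of a Pinsker sum are nonzero. -/
lemma summable_pinsker_terms {b : ℕ → ℝ} (hb : Tendsto b atTop atTop) {κ : ℝ} (hκ : 0 < κ) :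
    Summable fun j => b j * max (1 - κ * b j) 0 := by
  obtain ⟨J, hJ⟩ := eventually_atTop.1 (hb.eventually_ge_atTop (1 / κ))
  refine summable_of_ne_finset_zero (s := Finset.range J) fun j hj => ?_
  have := hJ j (by simpa using hj)
  rw [div_le_iff₀' hκ] at this
  rw [max_eq_right (by linarith), mul_zero]

lemma pinsker_sum_le {b : ℕ → ℝ} (hpos : ∀ j, 0 < b j) {κ A B : ℝ} (hκ : 0 < κ) {W : ℕ}
    (hA : ∀ j < W, b j ≤ A) (hB : ∀ j, W ≤ j → B ≤ b j) (h : 1 ≤ κ * B) :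
    ∑' j, b j * max (1 - κ * b j) 0 ≤ W * A := by
  rw [tsum_eq_sum (s := Finset.range W)]
  · calc ∑ j ∈ Finset.range W, b j * max (1 - κ * b j) 0
        ≤ ∑ _j ∈ Finset.range W, A := by
          refine Finset.sum_le_sum fun j hj => ?_
          have h1 : max (1 - κ * b j) 0 ≤ 1 :=
            max_le (by linarith [mul_pos hκ (hpos j)]) zero_le_one
          exact (mul_le_of_le_one_right (hpos j).le h1).trans (hA j (Finset.mem_range.1 hj))
      _ = W * A := by simp
  · intro j hj
    have := mul_le_mul_of_nonneg_left (hB j (by simpa using hj)) hκ.le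
    rw [max_eq_right (by linarith), mul_zero]

lemma le_pinsker_sum {b : ℕ → ℝ} (hpos : ∀ j, 0 < b j) (hb : Tendsto b atTop atTop)
    {κ A : ℝ} (hκ : 0 < κ) {W M : ℕ} (hA : ∀ j, W ≤ j → j < W + M → b j = A) :
    M * (A * (1 - κ * A)) ≤ ∑' j, b j * max (1 - κ * b j) 0 := by
  have hle : ∑ j ∈ Finset.Ico W (W + M), A * (1 - κ * A) ≤
      ∑ j ∈ Finset.Ico W (W + M), b j * max (1 - κ * b j) 0 := by
    refine Finset.sum_le_sum fun j hj => ?_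
    rw [Finset.mem_Ico] at hj
    rw [← hA j hj.1 hj.2]
    exact mul_le_mul_of_nonneg_left (le_max_left _ _) (hpos j).le
  refine le_trans (by simp) (hle.trans ?_)
  exact (summable_pinsker_terms hb hκ).sum_le_tsum _
    fun j _ => mul_nonneg (hpos j).le (le_max_right _ _)

lemma blockN_eq_of_threshold {s κ : ℝ} {lam : ℕ → ℝ} {V : ℕ} (hV : 1 ≤ V) (hs : 0 ≤ s)
    (hpos : ∀ j, 1 ≤ j → 0 < lam j) (hanti : ∀ i j, 1 ≤ i → i ≤ j → lam j ≤ lam i)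
    (hlt : κ < lam V ^ (s / 2)) (hge : lam (V + 1) ^ (s / 2) ≤ κ) : blockN s lam κ = V := by
  have : {j : ℕ | 1 ≤ j ∧ κ < lam j ^ (s / 2)} = Set.Icc 1 V := by
    ext j
    refine and_congr_right fun hj => ⟨fun h => ?_, fun h => ?_⟩
    · by_contra! hVj
      exact absurd h (not_lt.2 ((Real.rpow_le_rpow (hpos j hj).le
        (hanti (V + 1) j (by omega) hVj) (by positivity)).trans hge))
    · exact hlt.trans_le (Real.rpow_le_rpow (hpos V hV).le (hanti j V hj h) (by positivity))
  rw [blockN, this, csSup_Icc hV]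

lemma blockN_eq_vdim {s R σ κ : ℝ} (hs : 0 < s) (hσ : 0 < σ) {n d q : ℕ} (hn : 0 < n)
    (hd : 1 ≤ d) {lam m : ℕ → ℝ}
    (hpos : ∀ j, 1 ≤ j → 0 < lam j) (hanti : ∀ i j, 1 ≤ i → i ≤ j → lam j ≤ lam i)
    (hlim : Tendsto lam atTop (𝓝 0))
    (hblock : ∀ k ≤ q + 1, ∀ j : ℕ, vprev d k < j → (j : ℝ) ≤ vdim d k → lam j = m k)
    (hκ : 0 < κ) (hR : pinskerLHS s σ n lam κ = R)
    (hup : vprev d q * (m (q - 1) ^ (-(s / 2)) * m q ^ (-(s / 2))) < R / σ ^ 2 * n)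
    (hlow : R / σ ^ 2 * n < sphDim d q * (m q ^ (-(s / 2)) *
      (m (q + 1) ^ (-(s / 2)) - m q ^ (-(s / 2))))) :
    (blockN s lam κ : ℝ) = vdim d q := by
  set b : ℕ → ℝ := fun j => lam (j + 1) ^ (-(s / 2)) with hb
  have hbpos : ∀ j, 0 < b j := fun j => Real.rpow_pos_of_pos (hpos _ (by omega)) _
  have hblim : Tendsto b atTop atTop := by
    have h0 : Tendsto (fun j => lam (j + 1)) atTop (𝓝[>] 0) :=
      tendsto_nhdsWithin_iff.2
        ⟨hlim.comp (tendsto_add_atTop_nat 1), Eventually.of_forall fun j => hpos _ (by omega)⟩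
    exact (tendsto_rpow_neg_nhdsGT_zero (by linarith)).comp h0
  have hbmono : Monotone b := fun i j hij =>
    Real.rpow_le_rpow_of_nonpos (hpos _ (by omega)) (hanti _ _ (by omega) (by omega))
      (by linarith)
  have hn' : (0 : ℝ) < n := by exact_mod_cast hn
  have hsum : ∑' j, b j * max (1 - κ * b j) 0 = R / σ ^ 2 * n * κ := by
    rw [← hR, pinskerLHS]
    change _ = σ ^ 2 / (n * κ) * (∑' j, b j * max (1 - κ * b j) 0) / σ ^ 2 * n * κ
    generalize ∑' j, b j * max (1 - κ * b j) 0 = S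
    field_simp
  set v : ℕ → ℕ := fun k => ∑ i ∈ Finset.range k, sphDimNat d i
  have hv : ∀ k, vprev d k = v k := vprev_eq_natCast hd
  have hvs : ∀ k, v (k + 1) = v k + sphDimNat d k := fun k => Finset.sum_range_succ _ _
  have hbm : ∀ k ≤ q + 1, ∀ j, v k ≤ j → j < v (k + 1) → b j = m k ^ (-(s / 2)) := by
    intro k hk j h1 h2
    rw [hb]
    dsimp only
    rw [hblock k hk (j + 1)]
    · rw [hv]; exact_mod_cast Nat.lt_succ_of_le h1
    · rw [← vprev_succ, hv]; exact_mod_cast h2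
  have hp := sphDimNat_pos hd
  have hvq : v q < v (q + 1) := by rw [hvs]; exact Nat.lt_add_of_pos_right (hp q)
  have hvq' : v (q + 1) < v (q + 1 + 1) := by
    rw [hvs (q + 1)]; exact Nat.lt_add_of_pos_right (hp _)
  set A := m q ^ (-(s / 2))
  set B := m (q + 1) ^ (-(s / 2))
  have hAeq : b (v (q + 1) - 1) = A := hbm q (by omega) _ (by omega) (by omega)
  have hAeq' : b (v q) = A := hbm q (by omega) _ le_rfl hvq
  have hBeq : b (v (q + 1)) = B := hbm (q + 1) le_rfl _ le_rfl hvq'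
  have hApos : 0 < A := hAeq' ▸ hbpos _
  have hBpos : 0 < B := hBeq ▸ hbpos _
  have hlt : κ * A < 1 := by
    by_contra! h
    have hle : ∀ j < v q, b j ≤ m (q - 1) ^ (-(s / 2)) := by
      intro j hj
      rcases q with _ | q
      · simp [v] at hj
      · have := hvs q
        have := hp q
        rw [Nat.add_sub_cancel, ← hbm q (by omega) (v (q + 1) - 1) (by omega) (by omega)]
        exact hbmono (by omega)
    have h1 := pinsker_sum_le hbpos hκ hle (fun j hj => hAeq' ▸ hbmono hj) h
    rw [hsum] at h1
    have h2 : R / σ ^ 2 * n * 1 ≤ R / σ ^ 2 * n * (κ * A) := by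
      refine mul_le_mul_of_nonneg_left h ?_
      have : 0 ≤ R / σ ^ 2 * n * κ :=
        hsum ▸ tsum_nonneg fun j => mul_nonneg (hbpos j).le (le_max_right _ _)
      exact nonneg_of_mul_nonneg_left this hκ
    have h3 := mul_le_mul_of_nonneg_right h1 hApos.le
    rw [hv] at hup
    linarith
  have hge : 1 ≤ κ * B := by
    by_contra! h
    have h1 := le_pinsker_sum hbpos hblim hκ (W := v q) (M := sphDimNat d q) (A := A)
      fun j h1 h2 => hbm q (by omega) j h1 (by rw [hvs]; exact h2)
    rw [hsum] at h1
    rw [sphDim_eq_natCast hd] at hlow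
    have h2 := mul_lt_mul_of_pos_right hlow hκ
    have h3 : (sphDimNat d q : ℝ) * (A * (κ * B)) ≤ sphDimNat d q * (A * 1) := by gcongr
    linarith
  have hinv : ∀ j, lam (j + 1) ^ (s / 2) = (b j)⁻¹ := fun j => by
    rw [hb]; simp [Real.rpow_neg (hpos (j + 1) (by omega)).le]
  rw [← vprev_succ, hv, Nat.cast_inj]
  refine blockN_eq_of_threshold (by omega) hs.le hpos hanti ?_ ?_
  · have := hinv (v (q + 1) - 1)
    rw [Nat.sub_add_cancel (by omega), hAeq] at this
    rw [this, lt_inv_comm₀ hκ hApos, ← one_div, lt_div_iff₀ hκ]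
    linarith
  · rw [hinv, hBeq, inv_le_comm₀ hBpos hκ, ← one_div, div_le_iff₀ hκ]
    linarith

lemma eventually_lt_of_isLittleO {f g : ℕ → ℝ} (h : f =o[atTop] g)
    (hg : ∀ᶠ d in atTop, 0 < g d) : ∀ᶠ d in atTop, f d < g d := by
  filter_upwards [h.bound (one_half_pos), hg] with d h1 h2
  rw [Real.norm_of_nonneg h2.le] at h1
  linarith [le_abs_self (f d), Real.norm_eq_abs (f d)]

/-- Between the critical exponents `(q-1)(s+1) + s/2` and `q(s+1) + s/2`, the cutoff sits at
the end of the `q`-th block. -/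
lemma eventually_blockN_eq_vdim {s R σ α γ : ℝ} (hs : 0 < s) (hR : 0 < R) (hσ : 0 < σ)
    (hα : 0 < α) {q : ℕ} {c : ℕ → ℝ} (hc : ∀ k ≤ q + 1, 0 < c k)
    {n : ℕ → ℕ} (hn : ∀ d, 0 < n d)
    (hnlim : Tendsto (fun d : ℕ => (n d : ℝ) / (d : ℝ) ^ γ) atTop (𝓝 α))
    {μ : ℕ → ℕ → ℝ}
    (hμlim : ∀ k ≤ q + 1, Tendsto (fun d : ℕ => (d : ℝ) ^ k * μ d k) atTop (𝓝 (c k)))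
    (hμorder : ∀ᶠ d in atTop, μ d (q + 1) < μ d q)
    {lam : ℕ → ℕ → ℝ}
    (hpos : ∀ d j, 1 ≤ j → 0 < lam d j)
    (hanti : ∀ d i j, 1 ≤ i → i ≤ j → lam d j ≤ lam d i)
    (hlim : ∀ d, Tendsto (lam d) atTop (𝓝 0))
    (hblock : ∀ᶠ d in atTop, ∀ k ≤ q + 1, ∀ j : ℕ,
      vprev d k < (j : ℝ) → (j : ℝ) ≤ vdim d k → lam d j = μ d k)
    {κ : ℕ → ℝ} (hκ : ∀ d, 0 < κ d ∧ pinskerLHS s σ (n d) (lam d) (κ d) = R)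
    (hγ₁ : ((q : ℝ) - 1) * (s + 1) + s / 2 < γ) (hγ₂ : γ < (q : ℝ) * (s + 1) + s / 2) :
    ∀ᶠ d in atTop, (blockN s (lam d) (κ d) : ℝ) = vdim d q := by
  have hnΘ : (fun d => R / σ ^ 2 * (n d : ℝ)) =Θ[atTop] fun d : ℕ => (d : ℝ) ^ γ :=
    (isTheta_const_mul_left (by positivity)).2
      (isTheta_of_div_tendsto_nhds_ne_zero hnlim hα.ne').symm
  have hBΘ : ∀ k ≤ q + 1, (fun d => μ d k ^ (-(s / 2))) =Θ[atTop]
      fun d : ℕ => (d : ℝ) ^ (k * (s / 2)) :=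
    fun k hk => rpow_neg_isTheta (hc k hk) s (hμlim k hk)
  have hμpos : ∀ k ≤ q + 1, ∀ᶠ d in atTop, 0 < μ d k := by
    intro k hk
    filter_upwards [(hμlim k hk).eventually (lt_mem_nhds (hc k hk))] with d hd
    exact pos_of_mul_pos_right hd (by positivity)
  have hup : ∀ᶠ d in atTop, vprev d q * (μ d (q - 1) ^ (-(s / 2)) * μ d q ^ (-(s / 2))) <
      R / σ ^ 2 * n d := by
    refine eventually_lt_of_isLittleO (IsLittleO.trans_isTheta ?_ hnΘ.symm)
      (Eventually.of_forall fun d => by have := hn d; positivity)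
    rcases q with _ | q
    · simp [vprev]
    · simp only [vprev_succ, Nat.add_sub_cancel]
      refine ((vdim_isBigO q).mul ((hBΘ q (by omega)).1.mul (hBΘ (q + 1) (by omega)).1)
        ).trans_isLittleO ((natCast_rpow_isLittleO hγ₁).congr' ?_ EventuallyEq.rfl)
      filter_upwards [eventually_gt_atTop 0] with d hd
      have hd' : (0 : ℝ) < d := by exact_mod_cast hd
      rw [← Real.rpow_add hd', ← Real.rpow_add hd']
      congr 1
      push_cast
      ring
  have hlow : ∀ᶠ d in atTop, R / σ ^ 2 * n d < sphDim d q * (μ d q ^ (-(s / 2)) *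
      (μ d (q + 1) ^ (-(s / 2)) - μ d q ^ (-(s / 2)))) := by
    refine eventually_lt_of_isLittleO (hnΘ.trans_isLittleO ?_) ?_
    · have hdiff : (fun d => μ d (q + 1) ^ (-(s / 2)) - μ d q ^ (-(s / 2))) =Θ[atTop]
          fun d : ℕ => (d : ℝ) ^ (((q + 1 : ℕ) : ℝ) * (s / 2)) := by
        simp only [sub_eq_add_neg]
        refine (hBΘ (q + 1) le_rfl).add_isLittleO (IsLittleO.neg_left ?_)
        refine (hBΘ q (by omega)).trans_isLittleO (natCast_rpow_isLittleO ?_)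
        gcongr
        exact Nat.lt_succ_self q
      refine IsLittleO.trans_isTheta ?_
        ((sphDim_isTheta q).mul ((hBΘ q (by omega)).mul hdiff)).symm
      refine (natCast_rpow_isLittleO hγ₂).congr' EventuallyEq.rfl ?_
      filter_upwards [eventually_gt_atTop 0] with d hd
      have hd' : (0 : ℝ) < d := by exact_mod_cast hd
      rw [← Real.rpow_add hd', ← Real.rpow_add hd']
      congr 1
      push_cast
      ring
    · filter_upwards [hμpos q (by omega), hμpos (q + 1) le_rfl, hμorder,
        eventually_ge_atTop 1] with d h1 h2 h3 hd
      have h4 : 0 < sphDim d q := by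
        rw [sphDim_eq_natCast hd]; exact_mod_cast sphDimNat_pos hd q
      have h5 := sub_pos.2 (Real.rpow_lt_rpow_of_neg h2 h3 (show -(s / 2) < 0 by linarith))
      positivity
  filter_upwards [hup, hlow, hblock, eventually_ge_atTop 1] with d h1 h2 h3 hd
  exact blockN_eq_vdim hs hσ (hn d) hd (hpos d) (hanti d) (hlim d) h3 (hκ d).1 (hκ d).2 h1 h2

/-- If `γ < p(s+1) + s/2` then `N(d) = v_p(d)` for all large `d`; if `γ > p(s+1) + s/2`
then `N(d) = v_{p+1}(d)` for all large `d`. -/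
theorem statement9
    (s R σ α γ : ℝ) (hs : 0 < s) (hR : 0 < R) (hσ : 0 < σ) (hα : 0 < α) (hγ : 0 < γ)
    (p : ℕ) (hp : p = ⌊γ / (s + 1)⌋₊)
    (a : ℕ → ℝ) (ha : ∀ k ≤ p + 3, 0 < a k)
    (n : ℕ → ℕ) (hn : ∀ d, 0 < n d)
    (hnlim : Tendsto (fun d : ℕ => (n d : ℝ) / (d : ℝ) ^ γ) atTop (nhds α))
    (μ : ℕ → ℕ → ℝ)
    (hμlim : ∀ k ≤ p + 3, Tendsto (fun d : ℕ => (d : ℝ) ^ k * μ d k) atTop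
      (nhds (a k * Nat.factorial k)))
    (hμorder : ∀ᶠ d in atTop, (∀ k < p + 2, μ d (k + 1) < μ d k) ∧ 0 < μ d (p + 2))
    (lam : ℕ → ℕ → ℝ)
    (hlampos : ∀ d j, 1 ≤ j → 0 < lam d j)
    (hlamanti : ∀ d i j, 1 ≤ i → i ≤ j → lam d j ≤ lam d i)
    (hlamlim : ∀ d, Tendsto (lam d) atTop (nhds 0))
    (hblock : ∀ᶠ d in atTop, ∀ k ≤ p + 2, ∀ j : ℕ,
      vprev d k < (j : ℝ) → (j : ℝ) ≤ vdim d k → lam d j = μ d k)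
    (κstar : ℕ → ℝ)
    (hκ : ∀ d, 0 < κstar d ∧ pinskerLHS s σ (n d) (lam d) (κstar d) = R)
    :
    (γ < (p : ℝ) * (s + 1) + s / 2 →
      ∀ᶠ d in atTop, (blockN s (lam d) (κstar d) : ℝ) = vdim d p) ∧
    ((p : ℝ) * (s + 1) + s / 2 < γ →
      ∀ᶠ d in atTop, (blockN s (lam d) (κstar d) : ℝ) = vdim d (p + 1)) := by
  have hs1 : 0 < s + 1 := by linarith
  have hpγ : (p : ℝ) * (s + 1) ≤ γ := by
    rw [← le_div_iff₀ hs1, hp]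
    exact Nat.floor_le (by positivity)
  have hγp : γ < ((p : ℝ) + 1) * (s + 1) := by
    rw [← div_lt_iff₀ hs1, hp]
    exact Nat.lt_floor_add_one _
  have key : ∀ q ≤ p + 1, ((q : ℝ) - 1) * (s + 1) + s / 2 < γ →
      γ < (q : ℝ) * (s + 1) + s / 2 →
      ∀ᶠ d in atTop, (blockN s (lam d) (κstar d) : ℝ) = vdim d q := by
    intro q hq h1 h2
    refine eventually_blockN_eq_vdim hs hR hσ hα (c := fun k => a k * Nat.factorial k)
      (fun k hk => mul_pos (ha k (by omega)) (by positivity)) hn hnlim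
      (fun k hk => hμlim k (by omega)) (hμorder.mono fun d h => h.1 q (by omega))
      hlampos hlamanti hlamlim (hblock.mono fun d h k hk => h k (by omega)) hκ h1 h2
  refine ⟨fun h => key p (by omega) ?_ h, fun h => key (p + 1) le_rfl ?_ ?_⟩
  · linarith
  · push_cast
    linarith
  · push_cast
    linarith
end

section
/- Under the block eigenvalue setup, suppose p(s+1) + s ≤ γ < (p+1)(s+1). Then D*(d) is asymptotically equivalent to R · a_{p+1}^s · ((p+1)!)^s · d^{−(p+1)s} + (σ²/(α · p!)) · d^{p−γ}, i.e. lim_{d→∞} D*(d) / [ R · a_{p+1}^s · ((p+1)!)^s · d^{−(p+1)s} + (σ²/(α · p!)) · d^{p−γ} ] = 1. -/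
open Filter

/-- `u d ∼ C d ^ e`, in the form `u d / d ^ e → C`. -/
def PowAsymp (u : ℕ → ℝ) (C e : ℝ) : Prop :=
  Tendsto (fun d : ℕ => u d / (d : ℝ) ^ e) atTop (nhds C)

namespace PowAsymp

variable {u v : ℕ → ℝ} {C C' e e' : ℝ}

theorem mul (hu : PowAsymp u C e) (hv : PowAsymp v C' e') :
    PowAsymp (fun d => u d * v d) (C * C') (e + e') := by
  refine (Tendsto.mul hu hv).congr' ?_
  filter_upwards [eventually_gt_atTop 0] with d hd
  have hd' : (0 : ℝ) < d := by exact_mod_cast hd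
  rw [Real.rpow_add hd', div_mul_div_comm]

theorem const (c : ℝ) : PowAsymp (fun _ => c) c 0 := by
  simp [PowAsymp]

theorem const_mul (c : ℝ) (hu : PowAsymp u C e) : PowAsymp (fun d => c * u d) (c * C) e := by
  simpa using (const c).mul hu

theorem rpow (hu : PowAsymp u C e) (hC : 0 < C) (hpos : ∀ᶠ d in atTop, 0 ≤ u d) (r : ℝ) :
    PowAsymp (fun d => u d ^ r) (C ^ r) (e * r) := by
  refine (Tendsto.rpow_const hu (Or.inl hC.ne')).congr' ?_
  filter_upwards [hpos] with d hd
  rw [Real.div_rpow hd (by positivity), ← Real.rpow_mul (by positivity)]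

theorem inv (hu : PowAsymp u C e) (hC : C ≠ 0) : PowAsymp (fun d => (u d)⁻¹) C⁻¹ (-e) := by
  refine (Tendsto.inv₀ hu hC).congr fun d => ?_
  rw [Real.rpow_neg (by positivity), inv_div, div_inv_eq_mul, mul_comm, div_eq_mul_inv]

theorem congr' (hu : PowAsymp u C e) (h : u =ᶠ[atTop] v) : PowAsymp v C e :=
  Tendsto.congr' (h.mono fun d hd => by simp only [hd]) hu

theorem tendsto_zero (hu : PowAsymp u C e) (he : e < 0) : Tendsto u atTop (nhds 0) := by
  have h1 : Tendsto (fun d : ℕ => (d : ℝ) ^ e) atTop (nhds 0) := by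
    have := (tendsto_rpow_neg_atTop (neg_pos.2 he)).comp tendsto_natCast_atTop_atTop
    simpa [Function.comp_def] using this
  have h2 := Tendsto.mul hu h1
  rw [mul_zero] at h2
  refine h2.congr' ?_
  filter_upwards [eventually_gt_atTop 0] with d hd
  have hd' : (0 : ℝ) < d := by exact_mod_cast hd
  have := (Real.rpow_pos_of_pos hd' e).ne'
  field_simp

theorem eventually_pos (hu : PowAsymp u C e) (hC : 0 < C) : ∀ᶠ d in atTop, 0 < u d := by
  filter_upwards [Tendsto.eventually_const_lt hC hu, eventually_gt_atTop 0] with d hd hd0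
  have hd' : (0 : ℝ) < d := by exact_mod_cast hd0
  exact (div_pos_iff_of_pos_right (Real.rpow_pos_of_pos hd' e)).1 hd

theorem of_tendsto (hu : Tendsto u atTop (nhds C)) : PowAsymp u C 0 := by
  simpa [PowAsymp] using hu

theorem weaken (hu : PowAsymp u C e) (he : e < e') : PowAsymp u 0 e' := by
  have h := PowAsymp.mul hu (v := fun _ => 1) (C' := 0) (e' := e' - e) ?_
  · simpa using h
  · have := (tendsto_rpow_neg_atTop (sub_pos.2 he)).comp tendsto_natCast_atTop_atTop
    refine this.congr fun d => ?_
    simp only [Function.comp]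
    rw [Real.rpow_neg (by positivity), one_div]

theorem add (hu : PowAsymp u C e) (hv : PowAsymp v C' e) :
    PowAsymp (fun d => u d + v d) (C + C') e :=
  (Tendsto.add hu hv).congr fun d => by rw [add_div]

theorem sub (hu : PowAsymp u C e) (hv : PowAsymp v C' e) :
    PowAsymp (fun d => u d - v d) (C - C') e :=
  (Tendsto.sub hu hv).congr fun d => by rw [sub_div]

/-- A sum of two positive power asymptotics, with possibly different exponents. -/
theorem tendsto_add_div_add (hu : PowAsymp u C e) (hv : PowAsymp v C' e')
    (hC : 0 < C) (hC' : 0 < C') :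
    Tendsto (fun d : ℕ => (u d + v d) / (C * (d : ℝ) ^ e + C' * (d : ℝ) ^ e'))
      atTop (nhds 1) := by
  have h1 : Tendsto (fun d : ℕ => u d / (d : ℝ) ^ e / C) atTop (nhds 1) := by
    simpa [hC.ne'] using Tendsto.div_const hu C
  have h2 : Tendsto (fun d : ℕ => v d / (d : ℝ) ^ e' / C') atTop (nhds 1) := by
    simpa [hC'.ne'] using Tendsto.div_const hv C'
  have hmin := h1.min h2
  have hmax := h1.max h2
  rw [min_self] at hmin
  rw [max_self] at hmax
  have key : ∀ d : ℕ, 0 < d → 0 < C * (d : ℝ) ^ e ∧ 0 < C' * (d : ℝ) ^ e' ∧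
      u d = u d / (d : ℝ) ^ e / C * (C * (d : ℝ) ^ e) ∧
      v d = v d / (d : ℝ) ^ e' / C' * (C' * (d : ℝ) ^ e') := by
    intro d hd
    have hd' : (0 : ℝ) < d := by exact_mod_cast hd
    have h1 := Real.rpow_pos_of_pos hd' e
    have h2 := Real.rpow_pos_of_pos hd' e'
    refine ⟨by positivity, by positivity, ?_, ?_⟩ <;> field_simp
  refine tendsto_of_tendsto_of_tendsto_of_le_of_le' hmin hmax ?_ ?_
  · filter_upwards [eventually_gt_atTop 0] with d hd
    obtain ⟨p1, p2, e1, e2⟩ := key d hd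
    rw [le_div_iff₀ (by positivity), mul_add]
    exact add_le_add
      ((mul_le_mul_of_nonneg_right (min_le_left _ _) p1.le).trans_eq e1.symm)
      ((mul_le_mul_of_nonneg_right (min_le_right _ _) p2.le).trans_eq e2.symm)
  · filter_upwards [eventually_gt_atTop 0] with d hd
    obtain ⟨p1, p2, e1, e2⟩ := key d hd
    rw [div_le_iff₀ (by positivity), mul_add]
    exact add_le_add
      (e1.trans_le (mul_le_mul_of_nonneg_right (le_max_left _ _) p1.le))
      (e2.trans_le (mul_le_mul_of_nonneg_right (le_max_right _ _) p2.le))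

end PowAsymp

theorem powAsymp_natCast : PowAsymp (fun d => (d : ℝ)) 1 1 := by
  refine tendsto_const_nhds.congr' ?_
  filter_upwards [eventually_gt_atTop 0] with d hd
  have hd' : (0 : ℝ) < d := by exact_mod_cast hd
  simp [hd'.ne']

theorem powAsymp_factorial_ratio (m : ℕ) :
    PowAsymp (fun d => (Nat.factorial (m + d - 1) : ℝ) / Nat.factorial (d - 1)) 1 m := by
  induction m with
  | zero =>
    refine (PowAsymp.const 1).congr' (Eventually.of_forall fun d => ?_) |> fun h => by simpa using h
    have : (Nat.factorial (d - 1) : ℝ) ≠ 0 := by positivity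
    simp [this]
  | succ m ih =>
    have h1 : PowAsymp (fun d => (m : ℝ) + d) 1 1 := by
      simpa using ((PowAsymp.const (m : ℝ)).weaken one_pos).add powAsymp_natCast
    have h2 := ih.mul h1
    rw [mul_one] at h2
    push_cast
    refine h2.congr' ?_
    filter_upwards [eventually_gt_atTop 0] with d hd
    obtain ⟨d, rfl⟩ := Nat.exists_eq_succ_of_ne_zero hd.ne'
    have e1 : m + 1 + d.succ - 1 = (m + d) + 1 := by omega
    have e2 : m + d.succ - 1 = m + d := by omega
    rw [e1, e2, Nat.factorial_succ]
    push_cast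
    ring

theorem powAsymp_sphDim (k : ℕ) :
    PowAsymp (fun d => sphDim d k) (1 / Nat.factorial k) k := by
  rcases k with _ | m
  · simpa [sphDim] using PowAsymp.const 1
  · have h1 : PowAsymp (fun d => (2 * (m + 1 : ℕ) - 1 : ℝ) + d) 1 1 := by
      simpa using ((PowAsymp.const (2 * (m + 1 : ℕ) - 1 : ℝ)).weaken one_pos).add powAsymp_natCast
    have h2 := ((h1.mul (powAsymp_factorial_ratio m)).const_mul
      (1 / ((m + 1 : ℕ) * Nat.factorial m : ℝ)))
    have e : (1 / Nat.factorial (m + 1) : ℝ) = 1 / ((m + 1 : ℕ) * Nat.factorial m : ℝ) * (1 * 1) := by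
      rw [Nat.factorial_succ]; push_cast; ring
    have e' : ((m + 1 : ℕ) : ℝ) = 1 + m := by push_cast; ring
    rw [← e, ← e'] at h2
    refine h2.congr' (Eventually.of_forall fun d => ?_)
    have e2 : m + 1 + d - 2 = m + d - 1 := by omega
    simp only [sphDim, Nat.add_one_ne_zero, if_false, e2, Nat.add_sub_cancel]
    have : (Nat.factorial (d - 1) : ℝ) ≠ 0 := by positivity
    have : (Nat.factorial m : ℝ) ≠ 0 := by positivity
    push_cast
    field_simp
    ring

theorem powAsymp_vprev_succ (k : ℕ) :
    PowAsymp (fun d => vprev d (k + 1)) (1 / Nat.factorial k) k := by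
  induction k with
  | zero => simpa [vprev] using powAsymp_sphDim 0
  | succ k ih =>
    have h := (ih.weaken (e' := ((k + 1 : ℕ) : ℝ)) (by push_cast; linarith)).add
      (powAsymp_sphDim (k + 1))
    rw [zero_add] at h
    refine h.congr' (Eventually.of_forall fun d => ?_)
    simp only [vprev]
    rw [Finset.sum_range_succ _ (k + 1)]

/-- The integer index at which block `k` starts (exclusive). -/
noncomputable def blockStart (d k : ℕ) : ℕ := ⌊vprev d k⌋₊

theorem blockStart_zero (d : ℕ) : blockStart d 0 = 0 := by
  simp [blockStart, vprev]

theorem powAsymp_blockStart_succ (k : ℕ) :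
    PowAsymp (fun d => (blockStart d (k + 1) : ℝ)) (1 / Nat.factorial k) k := by
  rcases k with _ | k
  · simpa [blockStart, vprev, sphDim] using PowAsymp.const 1
  · have h := powAsymp_vprev_succ (k + 1)
    have h' := h.sub ((PowAsymp.const 1).weaken (e' := ((k + 1 : ℕ) : ℝ)) (by positivity))
    rw [sub_zero] at h'
    refine tendsto_of_tendsto_of_tendsto_of_le_of_le' h' h ?_ ?_
    · refine Eventually.of_forall fun d => ?_
      dsimp only
      gcongr
      exact (Nat.sub_one_lt_floor _).le
    · filter_upwards [h.eventually_pos (by positivity)] with d hd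
      gcongr
      exact Nat.floor_le hd.le

theorem powAsymp_blockStart_sub (k : ℕ) :
    PowAsymp (fun d => (blockStart d (k + 1) : ℝ) - blockStart d k) (1 / Nat.factorial k) k := by
  have h : PowAsymp (fun d => (blockStart d k : ℝ)) 0 k := by
    rcases k with _ | k
    · simpa [blockStart_zero] using PowAsymp.const 0
    · exact (powAsymp_blockStart_succ k).weaken (by push_cast; linarith)
  simpa using (powAsymp_blockStart_succ k).sub h

theorem eventually_blockStart_lt (k : ℕ) :
    ∀ᶠ d in atTop, blockStart d k < blockStart d (k + 1) := by
  filter_upwards [(powAsymp_blockStart_sub k).eventually_pos (by positivity)] with d hd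
  exact_mod_cast sub_pos.1 hd

section Pinsker

variable {s σ R κ m m' : ℝ} {n V V' : ℕ} {lam : ℕ → ℝ}

theorem pinskerEll_nonneg (j : ℕ) : 0 ≤ pinskerEll s lam κ j := le_max_right _ _

theorem pinskerEll_le_one (hκ : 0 < κ) {j : ℕ} (hj : 0 < lam j) : pinskerEll s lam κ j ≤ 1 := by
  have := Real.rpow_pos_of_pos hj (-(s / 2))
  exact max_le (by nlinarith) zero_le_one

theorem pinskerEll_eq_zero (hs : 0 < s) (hκ : 0 < κ) {j : ℕ} (hj : 0 < lam j) (hm : lam j ≤ m)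
    (h : 1 ≤ κ * m ^ (-(s / 2))) : pinskerEll s lam κ j = 0 := by
  refine max_eq_right ?_
  have : m ^ (-(s / 2)) ≤ lam j ^ (-(s / 2)) :=
    Real.rpow_le_rpow_of_nonpos hj hm (by linarith)
  nlinarith

theorem pinskerLHS_eq_sum (h : ∀ j, V < j → pinskerEll s lam κ j = 0) :
    pinskerLHS s σ n lam κ =
      σ ^ 2 / (n * κ) * ∑ j ∈ Finset.Icc 1 V, lam j ^ (-(s / 2)) * pinskerEll s lam κ j := by
  unfold pinskerLHS
  rw [tsum_eq_sum (s := Finset.range V), Finset.sum_bij (fun j _ => j + 1)]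
  · intro j hj; simp at hj ⊢; omega
  · intro i _ j _ h; omega
  · intro j hj
    simp only [Finset.mem_Icc] at hj
    exact ⟨j - 1, by simp; omega, by omega⟩
  · intro j _; rfl
  · intro j hj
    have := h (j + 1) (by simp at hj; omega)
    rw [pinskerEll] at this
    rw [this, mul_zero]

theorem exists_pinskerEll_eq_zero (hs : 0 < s) (hκ : 0 < κ) (hpos : ∀ j, 1 ≤ j → 0 < lam j)
    (hlim : Tendsto lam atTop (nhds 0)) (V : ℕ) :
    ∃ U, V ≤ U ∧ ∀ j, U < j → pinskerEll s lam κ j = 0 := by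
  have hm : 0 < κ ^ (2 / s) := Real.rpow_pos_of_pos hκ _
  obtain ⟨U, hU⟩ := (hlim.eventually_lt_const hm).exists_forall_of_atTop
  refine ⟨max U V, le_max_right _ _, fun j hj => ?_⟩
  have h1 : U < j := (le_max_left _ _).trans_lt hj
  refine pinskerEll_eq_zero hs hκ (hpos j (by omega)) (hU j h1.le).le (le_of_eq ?_)
  rw [← Real.rpow_mul hκ.le]
  have : 2 / s * (-(s / 2)) = -1 := by field_simp
  rw [this, Real.rpow_neg_one, mul_inv_cancel₀ hκ.ne']

/-- If the blocks past index `V` are inactive, the noise budget is bounded by what the first `V`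
coordinates can absorb. -/
theorem mul_le_of_pinskerLHS_eq (hs : 0 < s) (hR : 0 < R) (hκ : 0 < κ) (hn : 0 < n)
    (hpos : ∀ j, 1 ≤ j → 0 < lam j) (hm : 0 < m)
    (hV : ∀ j, 1 ≤ j → j ≤ V → m ≤ lam j) (hV' : ∀ j, V < j → lam j ≤ m')
    (hE : pinskerLHS s σ n lam κ = R) (hκm : 1 ≤ κ * m' ^ (-(s / 2))) :
    n * R ≤ σ ^ 2 * (V * m ^ (-(s / 2)) * m' ^ (-(s / 2))) := by
  have hn' : (0 : ℝ) < n := by exact_mod_cast hn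
  rw [pinskerLHS_eq_sum fun j hj =>
    pinskerEll_eq_zero hs hκ (hpos j (by omega)) (hV' j hj) hκm] at hE
  have hS : ∑ j ∈ Finset.Icc 1 V, lam j ^ (-(s / 2)) * pinskerEll s lam κ j
      ≤ V * m ^ (-(s / 2)) := by
    have := Finset.sum_le_card_nsmul (Finset.Icc 1 V)
      (fun j => lam j ^ (-(s / 2)) * pinskerEll s lam κ j) (m ^ (-(s / 2))) ?_
    · simpa using this
    · intro j hj
      rw [Finset.mem_Icc] at hj
      have hj0 := hpos j hj.1
      calc lam j ^ (-(s / 2)) * pinskerEll s lam κ j ≤ lam j ^ (-(s / 2)) * 1 := by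
            gcongr; exact pinskerEll_le_one hκ hj0
        _ ≤ m ^ (-(s / 2)) := by
            rw [mul_one]; exact Real.rpow_le_rpow_of_nonpos hm (hV j hj.1 hj.2) (by linarith)
  set τ := m' ^ (-(s / 2))
  have hτ : 0 < τ := by
    by_contra! h
    nlinarith
  set S := ∑ j ∈ Finset.Icc 1 V, lam j ^ (-(s / 2)) * pinskerEll s lam κ j
  have h1 : n * R * κ = σ ^ 2 * S := by
    rw [← hE]; field_simp
  calc (n : ℝ) * R ≤ n * R * (κ * τ) := le_mul_of_one_le_right (by positivity) hκm
    _ = σ ^ 2 * (S * τ) := by rw [← mul_assoc, h1]; ring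
    _ ≤ _ := by gcongr

theorem one_sub_le_of_pinskerLHS_eq (hs : 0 < s) (hσ : 0 < σ) (hR : 0 < R) (hκ : 0 < κ)
    (hn : 0 < n) (hpos : ∀ j, 1 ≤ j → 0 < lam j) (hlim : Tendsto lam atTop (nhds 0)) (hm : 0 < m)
    (hVV : V < V') (hV : ∀ j, V < j → j ≤ V' → lam j = m)
    (hE : pinskerLHS s σ n lam κ = R) (hκm : κ * m ^ (-(s / 2)) < 1) :
    1 - κ * m ^ (-(s / 2)) ≤
      R / σ ^ 2 * (n * (((V' : ℝ) - V)⁻¹ * (m ^ (-(s / 2)) * m ^ (-(s / 2)))⁻¹)) := by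
  have hn' : (0 : ℝ) < n := by exact_mod_cast hn
  obtain ⟨U, hU, hU0⟩ := exists_pinskerEll_eq_zero hs hκ hpos hlim V'
  rw [pinskerLHS_eq_sum hU0] at hE
  have hS : ((V' : ℝ) - V) * (m ^ (-(s / 2)) * (1 - κ * m ^ (-(s / 2)))) ≤
      ∑ j ∈ Finset.Icc 1 U, lam j ^ (-(s / 2)) * pinskerEll s lam κ j := by
    have hsub : Finset.Ioc V V' ⊆ Finset.Icc 1 U := by
      intro j hj
      simp only [Finset.mem_Ioc, Finset.mem_Icc] at hj ⊢
      omega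
    refine le_trans ?_ (Finset.sum_le_sum_of_subset_of_nonneg hsub fun j hj _ =>
      mul_nonneg (Real.rpow_nonneg (hpos j (Finset.mem_Icc.1 hj).1).le _) (pinskerEll_nonneg j))
    rw [Finset.sum_congr rfl (g := fun _ => m ^ (-(s / 2)) * (1 - κ * m ^ (-(s / 2))))]
    · simp [Nat.cast_sub hVV.le]
    · intro j hj
      rw [Finset.mem_Ioc] at hj
      rw [pinskerEll, hV j hj.1 hj.2, max_eq_left (by linarith)]
  have hτ : 0 < m ^ (-(s / 2)) := Real.rpow_pos_of_pos hm _
  set τ := m ^ (-(s / 2))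
  set S := ∑ j ∈ Finset.Icc 1 U, lam j ^ (-(s / 2)) * pinskerEll s lam κ j
  have h1 : n * R * κ / σ ^ 2 = S := by
    rw [← hE]; field_simp
  have hM : (0 : ℝ) < (V' : ℝ) - V := sub_pos.2 (by exact_mod_cast hVV)
  set M := (V' : ℝ) - V
  have e : R / σ ^ 2 * (n * (M⁻¹ * (τ * τ)⁻¹)) = (n * R / σ ^ 2 / τ) / (M * τ) := by
    field_simp
  rw [e, le_div_iff₀ (by positivity)]
  calc (1 - κ * τ) * (M * τ) = M * (τ * (1 - κ * τ)) := by ring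
    _ ≤ n * R * κ / σ ^ 2 := h1 ▸ hS
    _ = n * R / σ ^ 2 / τ * (κ * τ) := by field_simp
    _ ≤ n * R / σ ^ 2 / τ := mul_le_of_le_one_right (by positivity) hκm.le

theorem rpow_lt_iff_pinsker {x : ℝ} (hx : 0 < x) :
    κ < x ^ (s / 2) ↔ κ * x ^ (-(s / 2)) < 1 := by
  have := Real.rpow_pos_of_pos hx (s / 2)
  rw [Real.rpow_neg hx.le, ← div_eq_mul_inv, div_lt_one this]

theorem blockN_eq (hpos : ∀ j, 1 ≤ j → 0 < lam j)
    (hV : 1 ≤ V) (hlt : κ * lam V ^ (-(s / 2)) < 1)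
    (h : ∀ j, V < j → pinskerEll s lam κ j = 0) : blockN s lam κ = V := by
  refine IsGreatest.csSup_eq ⟨⟨hV, (rpow_lt_iff_pinsker (hpos V hV)).2 hlt⟩, ?_⟩
  rintro j ⟨hj, hj'⟩
  by_contra! hVj
  have h0 := h j hVj
  rw [rpow_lt_iff_pinsker (hpos j hj)] at hj'
  rw [pinskerEll, max_eq_left (by linarith)] at h0
  linarith

/-- When the last active block carries the eigenvalue `m`, the Pinsker equation eliminates that
block from `D*`. -/
theorem pinskerD_eq (hσ : 0 < σ) (hκ : 0 < κ) (hn : 0 < n)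
    (hpos : ∀ j, 1 ≤ j → 0 < lam j) (hm : 0 < m) (hVV : V < V')
    (hV : ∀ j, V < j → j ≤ V' → lam j = m) (hκm : κ * m ^ (-(s / 2)) < 1)
    (h : ∀ j, V' < j → pinskerEll s lam κ j = 0) (hE : pinskerLHS s σ n lam κ = R) :
    pinskerD s σ n lam κ = R * (κ * (m ^ (-(s / 2)))⁻¹) + σ ^ 2 * ((n : ℝ)⁻¹ *
      ∑ j ∈ Finset.Icc 1 V, (1 - lam j ^ (-(s / 2)) * (m ^ (-(s / 2)))⁻¹) *
        pinskerEll s lam κ j) := by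
  have hn' : (0 : ℝ) < n := by exact_mod_cast hn
  have hτ : 0 < m ^ (-(s / 2)) := Real.rpow_pos_of_pos hm _
  rw [pinskerD, blockN_eq hpos (by omega) (by rwa [hV V' hVV le_rfl]) h]
  rw [pinskerLHS_eq_sum h] at hE
  have hsub : ∑ j ∈ Finset.Icc 1 V, (1 - lam j ^ (-(s / 2)) * (m ^ (-(s / 2)))⁻¹) *
      pinskerEll s lam κ j = ∑ j ∈ Finset.Icc 1 V',
        (1 - lam j ^ (-(s / 2)) * (m ^ (-(s / 2)))⁻¹) * pinskerEll s lam κ j := by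
    refine Finset.sum_subset (Finset.Icc_subset_Icc le_rfl hVV.le) fun j hj hj' => ?_
    simp only [Finset.mem_Icc] at hj hj'
    rw [hV j (by omega) hj.2, mul_inv_cancel₀ hτ.ne', sub_self, zero_mul]
  rw [hsub, ← hE]
  set τ := m ^ (-(s / 2))
  have : ∑ j ∈ Finset.Icc 1 V', (1 - lam j ^ (-(s / 2)) * τ⁻¹) * pinskerEll s lam κ j =
      ∑ j ∈ Finset.Icc 1 V', pinskerEll s lam κ j -
      τ⁻¹ * ∑ j ∈ Finset.Icc 1 V', lam j ^ (-(s / 2)) * pinskerEll s lam κ j := by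
    rw [Finset.mul_sum, ← Finset.sum_sub_distrib]
    exact Finset.sum_congr rfl fun j _ => by ring
  rw [this]
  field_simp
  ring

theorem sum_residual_bounds (hs : 0 < s) (hκ : 0 < κ) (hm : 0 < m) (hm' : 0 < m')
    (hV : ∀ j, 1 ≤ j → j ≤ V → m ≤ lam j)
    (h1 : m ^ (-(s / 2)) * (m' ^ (-(s / 2)))⁻¹ ≤ 1)
    (h2 : κ * m ^ (-(s / 2)) ≤ 1) :
    V * ((1 - m ^ (-(s / 2)) * (m' ^ (-(s / 2)))⁻¹) * (1 - κ * m ^ (-(s / 2)))) ≤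
      ∑ j ∈ Finset.Icc 1 V, (1 - lam j ^ (-(s / 2)) * (m' ^ (-(s / 2)))⁻¹) *
        pinskerEll s lam κ j ∧
    ∑ j ∈ Finset.Icc 1 V, (1 - lam j ^ (-(s / 2)) * (m' ^ (-(s / 2)))⁻¹) *
        pinskerEll s lam κ j ≤ V := by
  have hτ : 0 < m' ^ (-(s / 2)) := Real.rpow_pos_of_pos hm' _
  have ht : ∀ j ∈ Finset.Icc 1 V, 0 < lam j ∧ lam j ^ (-(s / 2)) ≤ m ^ (-(s / 2)) := by
    intro j hj
    rw [Finset.mem_Icc] at hj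
    have := hV j hj.1 hj.2
    exact ⟨hm.trans_le this, Real.rpow_le_rpow_of_nonpos hm this (by linarith)⟩
  constructor
  · have := Finset.card_nsmul_le_sum (Finset.Icc 1 V)
      (fun j => (1 - lam j ^ (-(s / 2)) * (m' ^ (-(s / 2)))⁻¹) * pinskerEll s lam κ j)
      ((1 - m ^ (-(s / 2)) * (m' ^ (-(s / 2)))⁻¹) * (1 - κ * m ^ (-(s / 2)))) ?_
    · simpa using this
    · intro j hj
      obtain ⟨_, hj2⟩ := ht j hj
      have hA : 1 - m ^ (-(s / 2)) * (m' ^ (-(s / 2)))⁻¹ ≤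
          1 - lam j ^ (-(s / 2)) * (m' ^ (-(s / 2)))⁻¹ := by gcongr
      have hB : 1 - κ * m ^ (-(s / 2)) ≤ pinskerEll s lam κ j :=
        le_trans (by gcongr) (le_max_left _ _)
      exact mul_le_mul hA hB (by linarith) (by linarith)
  · have := Finset.sum_le_card_nsmul (Finset.Icc 1 V)
      (fun j => (1 - lam j ^ (-(s / 2)) * (m' ^ (-(s / 2)))⁻¹) * pinskerEll s lam κ j) 1 ?_
    · simpa using this
    · intro j hj
      obtain ⟨hj1, _⟩ := ht j hj
      have := Real.rpow_pos_of_pos hj1 (-(s / 2))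
      have h3 : 0 < lam j ^ (-(s / 2)) * (m' ^ (-(s / 2)))⁻¹ := by positivity
      calc _ ≤ 1 * pinskerEll s lam κ j :=
            mul_le_mul_of_nonneg_right (by linarith) (pinskerEll_nonneg j)
        _ ≤ 1 := by rw [one_mul]; exact pinskerEll_le_one hκ hj1

end Pinsker

theorem lam_eq_of_blockStart {d k j : ℕ} {lam : ℕ → ℝ} {m : ℝ}
    (h : ∀ j : ℕ, vprev d k < (j : ℝ) → (j : ℝ) ≤ vdim d k → lam j = m)
    (h1 : blockStart d k < j) (h2 : j ≤ blockStart d (k + 1)) : lam j = m := by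
  refine h j (Nat.lt_of_floor_lt h1) ?_
  exact (Nat.le_floor_iff' (by omega)).1 h2

/-- If `p(s+1) + s ≤ γ < (p+1)(s+1)` then
`D*(d) ∼ R a_{p+1}^s ((p+1)!)^s d^{−(p+1)s} + (σ²/(α p!)) d^{p−γ}`. -/
theorem statement10
    (s R σ α γ : ℝ) (hs : 0 < s) (hR : 0 < R) (hσ : 0 < σ) (hα : 0 < α) (hγ : 0 < γ)
    (p : ℕ) (hp : p = ⌊γ / (s + 1)⌋₊)
    (a : ℕ → ℝ) (ha : ∀ k ≤ p + 3, 0 < a k)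
    (n : ℕ → ℕ) (hn : ∀ d, 0 < n d)
    (hnlim : Tendsto (fun d : ℕ => (n d : ℝ) / (d : ℝ) ^ γ) atTop (nhds α))
    (μ : ℕ → ℕ → ℝ)
    (hμlim : ∀ k ≤ p + 3, Tendsto (fun d : ℕ => (d : ℝ) ^ k * μ d k) atTop
      (nhds (a k * Nat.factorial k)))
    (hμorder : ∀ᶠ d in atTop, (∀ k < p + 2, μ d (k + 1) < μ d k) ∧ 0 < μ d (p + 2))
    (lam : ℕ → ℕ → ℝ)
    (hlampos : ∀ d j, 1 ≤ j → 0 < lam d j)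
    (hlamanti : ∀ d i j, 1 ≤ i → i ≤ j → lam d j ≤ lam d i)
    (hlamlim : ∀ d, Tendsto (lam d) atTop (nhds 0))
    (hblock : ∀ᶠ d in atTop, ∀ k ≤ p + 2, ∀ j : ℕ,
      vprev d k < (j : ℝ) → (j : ℝ) ≤ vdim d k → lam d j = μ d k)
    (κstar : ℕ → ℝ)
    (hκ : ∀ d, 0 < κstar d ∧ pinskerLHS s σ (n d) (lam d) (κstar d) = R)
    (h1 : (p : ℝ) * (s + 1) + s ≤ γ) (h2 : γ < ((p : ℝ) + 1) * (s + 1)) :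
    Tendsto (fun d : ℕ => pinskerD s σ (n d) (lam d) (κstar d) /
      (R * a (p + 1) ^ s * (Nat.factorial (p + 1) : ℝ) ^ s * (d : ℝ) ^ (-(((p : ℝ) + 1) * s)) +
        σ ^ 2 / (α * Nat.factorial p) * (d : ℝ) ^ ((p : ℝ) - γ)))
      atTop (nhds 1) := by
  have hμ : ∀ k ≤ p + 3, PowAsymp (fun d => μ d k) (a k * Nat.factorial k) (-(k : ℝ)) := by
    intro k hk
    refine (hμlim k hk).congr fun d => ?_
    rw [Real.rpow_neg (by positivity), div_inv_eq_mul, Real.rpow_natCast, mul_comm]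
  have hc : ∀ k ≤ p + 3, 0 < a k * Nat.factorial k := fun k hk =>
    mul_pos (ha k hk) (by positivity)
  have hμpos : ∀ k ≤ p + 3, ∀ᶠ d in atTop, 0 < μ d k := fun k hk =>
    (hμ k hk).eventually_pos (hc k hk)
  have ht : ∀ k ≤ p + 3, PowAsymp (fun d => μ d k ^ (-(s / 2)))
      ((a k * Nat.factorial k) ^ (-(s / 2))) (-(k : ℝ) * -(s / 2)) := fun k hk =>
    (hμ k hk).rpow (hc k hk) ((hμpos k hk).mono fun _ h => h.le) _
  have htc : ∀ k ≤ p + 3, 0 < (a k * Nat.factorial k) ^ (-(s / 2)) := fun k hk =>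
    Real.rpow_pos_of_pos (hc k hk) _
  have hnA : PowAsymp (fun d => (n d : ℝ)) α γ := hnlim
  -- block structure of `lam`
  have hlam : ∀ᶠ d in atTop, ∀ k ≤ p + 2, ∀ j, blockStart d k < j →
      j ≤ blockStart d (k + 1) → lam d j = μ d k := by
    filter_upwards [hblock] with d hd k hk j
    exact lam_eq_of_blockStart (hd k hk)
  have hge : ∀ᶠ d in atTop, ∀ j, 1 ≤ j → j ≤ blockStart d (p + 1) → μ d p ≤ lam d j := by
    filter_upwards [hlam, eventually_blockStart_lt p] with d hd hlt j hj1 hj2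
    rw [← hd p (by omega) (blockStart d (p + 1)) hlt le_rfl]
    exact hlamanti d j _ hj1 hj2
  have hle : ∀ k ≤ p + 2, ∀ᶠ d in atTop, ∀ j, blockStart d k < j → lam d j ≤ μ d k := by
    intro k hk
    filter_upwards [hlam, eventually_blockStart_lt k] with d hd hlt j hj
    rw [← hd k hk (blockStart d k + 1) (by omega) hlt]
    exact hlamanti d _ _ (by omega) hj
  -- block `p + 1` is active
  have hact : ∀ᶠ d in atTop, κstar d * μ d (p + 1) ^ (-(s / 2)) < 1 := by
    have h0 : Tendsto (fun d => σ ^ 2 * ((blockStart d (p + 1) * μ d p ^ (-(s / 2)) *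
        μ d (p + 1) ^ (-(s / 2))) * (n d : ℝ)⁻¹)) atTop (nhds 0) :=
      (((((powAsymp_blockStart_succ p).mul (ht p (by omega))).mul
        (ht (p + 1) (by omega))).mul (hnA.inv hα.ne')).const_mul (σ ^ 2)).tendsto_zero
        (by push_cast; nlinarith)
    filter_upwards [h0.eventually_lt_const hR, hge, hle (p + 1) (by omega),
      hμpos p (by omega)] with d hd hge hle hm
    by_contra! hcon
    have := mul_le_of_pinskerLHS_eq hs hR (hκ d).1 (hn d) (hlampos d) hm hge hle (hκ d).2 hcon
    have hn' : (0 : ℝ) < n d := by exact_mod_cast hn d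
    rw [← mul_assoc, ← div_eq_mul_inv, div_lt_iff₀ hn'] at hd
    linarith
  -- at the critical level
  have hcrit : Tendsto (fun d => κstar d * μ d (p + 1) ^ (-(s / 2))) atTop (nhds 1) := by
    have h0 : Tendsto (fun d => R / σ ^ 2 * (n d *
        (((blockStart d (p + 1 + 1) : ℝ) - blockStart d (p + 1))⁻¹ *
          (μ d (p + 1) ^ (-(s / 2)) * μ d (p + 1) ^ (-(s / 2)))⁻¹))) atTop (nhds 0) :=
      ((hnA.mul (((powAsymp_blockStart_sub (p + 1)).inv (by positivity)).mul
        (((ht (p + 1) (by omega)).mul (ht (p + 1) (by omega))).inv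
          (mul_pos (htc (p + 1) (by omega)) (htc (p + 1) (by omega))).ne'))).const_mul
        (R / σ ^ 2)).tendsto_zero (by push_cast; nlinarith)
    have h3 := h0.const_sub 1
    rw [sub_zero] at h3
    refine tendsto_of_tendsto_of_tendsto_of_le_of_le' h3 tendsto_const_nhds ?_
      (hact.mono fun d h => h.le)
    filter_upwards [hact, hlam, eventually_blockStart_lt (p + 1),
      hμpos (p + 1) (by omega)] with d hd hl hlt hm
    have := one_sub_le_of_pinskerLHS_eq hs hσ hR (hκ d).1 (hn d) (hlampos d) (hlamlim d) hm hlt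
      (hl (p + 1) (by omega)) (hκ d).2 hd
    linarith
  have hτinv : PowAsymp (fun d => (μ d (p + 1) ^ (-(s / 2)))⁻¹) _ _ :=
    (ht (p + 1) (by omega)).inv (htc (p + 1) (by omega)).ne'
  have hκA : PowAsymp (fun d => κstar d) _ _ :=
    ((PowAsymp.of_tendsto hcrit).mul hτinv).congr' (by
      filter_upwards [hμpos (p + 1) (by omega)] with d hd
      exact mul_inv_cancel_right₀ (Real.rpow_pos_of_pos hd _).ne' _)
  -- blocks past `p + 1` are inactive
  have hinact : ∀ᶠ d in atTop, ∀ j, blockStart d (p + 1 + 1) < j →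
      pinskerEll s (lam d) (κstar d) j = 0 := by
    have hκt := hκA.mul (ht (p + 2) (by omega))
    have hC : 0 < 1 * ((a (p + 1) * Nat.factorial (p + 1)) ^ (-(s / 2)))⁻¹ *
        (a (p + 2) * Nat.factorial (p + 2)) ^ (-(s / 2)) := by
      have := htc (p + 1) (by omega)
      have := htc (p + 2) (by omega)
      positivity
    have h0 := (hκt.inv hC.ne').tendsto_zero (by push_cast; nlinarith)
    filter_upwards [h0.eventually_lt_const one_pos, hle (p + 2) le_rfl,
      hμpos (p + 2) (by omega)] with d hd hle hm j hj
    refine pinskerEll_eq_zero hs (hκ d).1 (hlampos d j (by omega)) (hle j hj) ?_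
    have hpos := mul_pos (hκ d).1 (Real.rpow_pos_of_pos hm (-(s / 2)))
    exact (inv_lt_one₀ hpos).1 hd |>.le
  -- the contribution of the blocks `0, …, p`
  have hrest : PowAsymp (fun d => ∑ j ∈ Finset.Icc 1 (blockStart d (p + 1)),
      (1 - lam d j ^ (-(s / 2)) * (μ d (p + 1) ^ (-(s / 2)))⁻¹) *
        pinskerEll s (lam d) (κstar d) j) (1 / Nat.factorial p) p := by
    have hr1 : Tendsto (fun d => μ d p ^ (-(s / 2)) * (μ d (p + 1) ^ (-(s / 2)))⁻¹)
        atTop (nhds 0) :=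
      ((ht p (by omega)).mul hτinv).tendsto_zero (by push_cast; nlinarith)
    have hr2 : Tendsto (fun d => κstar d * μ d p ^ (-(s / 2))) atTop (nhds 0) :=
      (hκA.mul (ht p (by omega))).tendsto_zero (by push_cast; nlinarith)
    have hfac := (hr1.const_sub 1).mul (hr2.const_sub 1)
    have hlow := (powAsymp_blockStart_succ p).mul (PowAsymp.of_tendsto hfac)
    simp only [sub_zero, mul_one, add_zero] at hlow
    have hev := hge.and ((hμpos p (by omega)).and ((hμpos (p + 1) (by omega)).and
      ((hr1.eventually_lt_const one_pos).and (hr2.eventually_lt_const one_pos))))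
    have hbd := hev.mono fun d ⟨hge, hm, hm', h1, h2⟩ =>
      sum_residual_bounds hs (hκ d).1 hm hm' hge h1.le h2.le
    refine tendsto_of_tendsto_of_tendsto_of_le_of_le' hlow (powAsymp_blockStart_succ p) ?_ ?_
    · filter_upwards [hbd] with d hd
      have := hd.1
      gcongr
    · filter_upwards [hbd] with d hd
      have := hd.2
      gcongr
  have hA := (hκA.mul hτinv).const_mul R
  have hB := ((hnA.inv hα.ne').mul hrest).const_mul (σ ^ 2)
  have hAC : R * (1 * ((a (p + 1) * Nat.factorial (p + 1) : ℝ) ^ (-(s / 2)))⁻¹ *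
      ((a (p + 1) * Nat.factorial (p + 1) : ℝ) ^ (-(s / 2)))⁻¹) =
      R * a (p + 1) ^ s * (Nat.factorial (p + 1) : ℝ) ^ s := by
    rw [one_mul, ← mul_inv, ← Real.rpow_add (hc (p + 1) (by omega)),
      ← Real.rpow_neg (hc (p + 1) (by omega)).le, mul_assoc,
      ← Real.mul_rpow (ha (p + 1) (by omega)).le (by positivity)]
    congr 2
    ring
  have hBC : σ ^ 2 * (α⁻¹ * (1 / Nat.factorial p)) = σ ^ 2 / (α * Nat.factorial p) := by
    field_simp
  rw [hAC] at hA
  rw [hBC] at hB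
  have hap := ha (p + 1) (by omega)
  have hfin := hA.tendsto_add_div_add hB (by positivity) (by positivity)
  have e1 : (0 + -(-((p + 1 : ℕ) : ℝ) * -(s / 2)) + -(-((p + 1 : ℕ) : ℝ) * -(s / 2))) =
      -(((p : ℝ) + 1) * s) := by push_cast; ring
  have e2 : -γ + (p : ℝ) = p - γ := by ring
  rw [e1, e2] at hfin
  refine hfin.congr' ?_
  filter_upwards [hact, hinact, hlam, eventually_blockStart_lt (p + 1),
    hμpos (p + 1) (by omega)] with d hd hin hl hlt hm
  rw [pinskerD_eq hσ (hκ d).1 (hn d) (hlampos d) hm hlt (hl (p + 1) (by omega)) hd hin (hκ d).2]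
end

section
/- Under the block eigenvalue setup, suppose p ≥ 1 and γ = p(s+1) (so that γ − p = ps). Then lim_{d→∞} d^{ps} · D*(d) = σ² / ( α · p! + σ² / (R · a_p^s · (p!)^s) ). -/
open Filter

/-- `n (n+1) ⋯ (n+l-1) ~ n^l`. -/
theorem tendsto_ascFactorial_div_pow (l : ℕ) :
    Tendsto (fun d : ℕ => (d.ascFactorial l : ℝ) / (d : ℝ) ^ l) atTop (nhds 1) := by
  induction l with
  | zero => simp
  | succ l ih =>
    have h1 : Tendsto (fun d : ℕ => 1 + (l : ℝ) / (d : ℝ)) atTop (nhds (1 + 0)) :=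
      tendsto_const_nhds.add (tendsto_const_div_atTop_nhds_zero_nat _)
    have h2 := h1.mul ih
    rw [add_zero, mul_one] at h2
    refine h2.congr' ?_
    filter_upwards [eventually_gt_atTop 0] with d hd
    have hd' : (d : ℝ) ≠ 0 := by positivity
    rw [Nat.ascFactorial_succ]
    push_cast
    field_simp
    ring

theorem sphDim_succ_succ (m l : ℕ) :
    sphDim (m + 1) (l + 1) =
      ((2 * (l + 1) + m : ℝ) / (l + 1)) * ((m + 1).ascFactorial l / l.factorial) := by
  have h : (m.factorial : ℝ) * (m + 1).ascFactorial l = (m + l).factorial := by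
    exact_mod_cast Nat.factorial_mul_ascFactorial m l
  have h0 : (m.factorial : ℝ) ≠ 0 := by positivity
  have h1 : l + 1 + (m + 1) - 2 = m + l := by omega
  simp only [sphDim, Nat.add_eq_zero_iff, one_ne_zero, and_false, if_false, h1,
    Nat.add_sub_cancel]
  rw [← h]
  push_cast
  field_simp
  ring

theorem tendsto_sphDim_div_pow (k : ℕ) :
    Tendsto (fun d : ℕ => sphDim d k / (d : ℝ) ^ k) atTop (nhds (1 / k.factorial)) := by
  rcases k with _ | l
  · simp [sphDim]
  · have h1 : Tendsto (fun d : ℕ => 1 + (2 * l + 1 : ℝ) / (d : ℝ)) atTop (nhds (1 + 0)) :=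
      tendsto_const_nhds.add (tendsto_const_div_atTop_nhds_zero_nat _)
    have h2 := (h1.mul (tendsto_ascFactorial_div_pow l)).div_const ((l + 1).factorial : ℝ)
    rw [add_zero, mul_one] at h2
    refine h2.congr' ?_
    filter_upwards [eventually_gt_atTop 0] with d hd
    obtain ⟨m, rfl⟩ : ∃ m, d = m + 1 := ⟨d - 1, by omega⟩
    rw [sphDim_succ_succ, Nat.factorial_succ]
    have : (l.factorial : ℝ) ≠ 0 := by positivity
    push_cast
    field_simp
    ring

theorem tendsto_vprev_div_pow (p : ℕ) :
    Tendsto (fun d : ℕ => vprev d p / (d : ℝ) ^ p) atTop (nhds 0) := by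
  simp only [vprev, Finset.sum_div]
  rw [← Finset.sum_const_zero (s := Finset.range p) (M := ℝ)]
  refine tendsto_finsetSum _ fun k hk => ?_
  have hkp : p - k ≠ 0 := by have := Finset.mem_range.1 hk; omega
  have h1 : Tendsto (fun d : ℕ => ((d : ℝ) ^ (p - k))⁻¹) atTop (nhds 0) :=
    ((tendsto_pow_atTop hkp).comp tendsto_natCast_atTop_atTop).inv_tendsto_atTop
  have h2 := (tendsto_sphDim_div_pow k).mul h1
  rw [mul_zero] at h2
  refine h2.congr' ?_
  filter_upwards [eventually_gt_atTop 0] with d hd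
  have hd' : (d : ℝ) ≠ 0 := by positivity
  have h3 : (d : ℝ) ^ p = (d : ℝ) ^ k * (d : ℝ) ^ (p - k) := by
    rw [← pow_add]; congr 1; have := Finset.mem_range.1 hk; omega
  rw [h3]
  field_simp

theorem vdim_eq_vprev_add (d k : ℕ) : vdim d k = vprev d k + sphDim d k :=
  Finset.sum_range_succ _ _

theorem tendsto_vdim_div_pow (p : ℕ) :
    Tendsto (fun d : ℕ => vdim d p / (d : ℝ) ^ p) atTop (nhds (1 / p.factorial)) := by
  have h := (tendsto_vprev_div_pow p).add (tendsto_sphDim_div_pow p)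
  rw [zero_add] at h
  refine h.congr fun d => ?_
  rw [vdim_eq_vprev_add, add_div]

theorem sphDim_nonneg {d : ℕ} (hd : 0 < d) (k : ℕ) : 0 ≤ sphDim d k := by
  obtain ⟨m, rfl⟩ : ∃ m, d = m + 1 := ⟨d - 1, by omega⟩
  rcases k with _ | l
  · simp [sphDim]
  · rw [sphDim_succ_succ]; positivity

theorem vprev_nonneg {d : ℕ} (hd : 0 < d) (k : ℕ) : 0 ≤ vprev d k :=
  Finset.sum_nonneg fun i _ => sphDim_nonneg hd i

/-- Rounding down does not change the growth rate along `d^p`, `p ≥ 1`. -/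
theorem tendsto_floor_div_pow {f : ℕ → ℝ} {p : ℕ} (hp : 1 ≤ p) {c : ℝ}
    (hf0 : ∀ᶠ d in atTop, 0 ≤ f d)
    (hf : Tendsto (fun d : ℕ => f d / (d : ℝ) ^ p) atTop (nhds c)) :
    Tendsto (fun d : ℕ => (⌊f d⌋₊ : ℝ) / (d : ℝ) ^ p) atTop (nhds c) := by
  have h1 : Tendsto (fun d : ℕ => ((d : ℝ) ^ p)⁻¹) atTop (nhds 0) :=
    ((tendsto_pow_atTop (by omega)).comp tendsto_natCast_atTop_atTop).inv_tendsto_atTop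
  have h2 := hf.sub h1
  rw [sub_zero] at h2
  refine tendsto_of_tendsto_of_tendsto_of_le_of_le' h2 hf ?_ ?_
  · filter_upwards [eventually_gt_atTop 0] with d hd
    have hd' : (0 : ℝ) < (d : ℝ) ^ p := by positivity
    rw [← one_div, ← sub_div]
    gcongr
    linarith [Nat.lt_floor_add_one (f d)]
  · filter_upwards [hf0] with d hd
    gcongr
    exact Nat.floor_le hd

theorem tendsto_sphDim_atTop {k : ℕ} (hk : 1 ≤ k) :
    Tendsto (fun d : ℕ => sphDim d k) atTop atTop := by
  have h1 : Tendsto (fun d : ℕ => (d : ℝ) ^ k) atTop atTop :=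
    (tendsto_pow_atTop (by omega)).comp tendsto_natCast_atTop_atTop
  have h2 := (tendsto_sphDim_div_pow k).pos_mul_atTop (by positivity) h1
  refine h2.congr' ?_
  filter_upwards [eventually_gt_atTop 0] with d hd
  have hd' : (d : ℝ) ≠ 0 := by positivity
  field_simp

theorem tsum_eq_sum_Ioc_of_forall_gt {f : ℕ → ℝ} {B : ℕ} (hf : ∀ j, B < j → f j = 0) :
    ∑' j : ℕ, f (j + 1) = ∑ j ∈ Finset.Ioc 0 B, f j := by
  rw [tsum_eq_sum (s := Finset.range B)
    (fun j hj => hf _ (by simp only [Finset.mem_range] at hj; omega)),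
    Finset.range_eq_Ico, Finset.sum_Ico_add' f 0 B 1]
  rfl

theorem sum_Ioc_le_tsum {f : ℕ → ℝ} (hf : ∀ j, 1 ≤ j → 0 ≤ f j)
    (hs : Summable fun j : ℕ => f (j + 1)) (A B : ℕ) :
    ∑ j ∈ Finset.Ioc A B, f j ≤ ∑' j : ℕ, f (j + 1) := by
  have h : ∑ j ∈ Finset.Ioc A B, f j = ∑ j ∈ Finset.Ico A B, f (j + 1) := by
    rw [Finset.sum_Ico_add' f A B 1]
    exact Finset.sum_congr
      (by ext j; simp only [Finset.mem_Ioc, Finset.mem_Ico]; omega) fun _ _ => rfl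
  rw [h]
  exact hs.sum_le_tsum _ fun j _ => hf _ (by omega)

theorem sum_Ioc_eq_mul {f : ℕ → ℝ} {A B : ℕ} (hAB : A ≤ B) {c : ℝ}
    (hf : ∀ j, A < j → j ≤ B → f j = c) :
    ∑ j ∈ Finset.Ioc A B, f j = ((B : ℝ) - A) * c := by
  rw [Finset.sum_congr rfl (fun j hj => hf j (Finset.mem_Ioc.1 hj).1 (Finset.mem_Ioc.1 hj).2)]
  simp [Nat.cast_sub hAB]

theorem rpow_mul_rpow_neg_half_sq {m : ℝ} (hm : 0 < m) (s : ℝ) :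
    m ^ s * (m ^ (-(s / 2)) * m ^ (-(s / 2))) = 1 := by
  rw [← Real.rpow_add hm, ← Real.rpow_add hm]
  ring_nf
  exact Real.rpow_zero m

section Block

variable {s σ R κ m : ℝ} {n A B : ℕ} {lam : ℕ → ℝ}

/-- The Pinsker equation solved for its series. -/
theorem tsum_eq_of_pinskerLHS_eq (hσ : 0 < σ) (hn : 0 < n) (hκ : 0 < κ)
    (h : pinskerLHS s σ n lam κ = R) :
    ∑' j : ℕ, lam (j + 1) ^ (-(s / 2)) * max (1 - κ * lam (j + 1) ^ (-(s / 2))) 0 =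
      R * n * κ / σ ^ 2 := by
  have hn' : (n : ℝ) ≠ 0 := by positivity
  rw [← h, pinskerLHS]
  generalize (∑' j : ℕ, lam (j + 1) ^ (-(s / 2)) * max (1 - κ * lam (j + 1) ^ (-(s / 2))) 0) = T
  field_simp

/-- A single eigenvalue block bounds the Pinsker constant from below. -/
theorem block_le_of_pinskerLHS_eq (hσ : 0 < σ) (hn : 0 < n) (hκ : 0 < κ)
    (hR : 0 < R) (hm : 0 < m) (hpos : ∀ j, 1 ≤ j → 0 < lam j) (hAB : A ≤ B)
    (hblock : ∀ j, A < j → j ≤ B → lam j = m) (h : pinskerLHS s σ n lam κ = R) :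
    ((B : ℝ) - A) * (1 - κ * m ^ (-(s / 2))) ≤
      κ * m ^ (-(s / 2)) * (R * n * m ^ s / σ ^ 2) := by
  have hT := tsum_eq_of_pinskerLHS_eq hσ hn hκ h
  have hn' : (0 : ℝ) < n := by positivity
  have hsum : Summable fun j : ℕ =>
      lam (j + 1) ^ (-(s / 2)) * max (1 - κ * lam (j + 1) ^ (-(s / 2))) 0 := by
    by_contra hns
    rw [tsum_eq_zero_of_not_summable hns] at hT
    have : 0 < R * n * κ / σ ^ 2 := by positivity
    linarith
  have hle := sum_Ioc_le_tsum
    (f := fun j => lam j ^ (-(s / 2)) * max (1 - κ * lam j ^ (-(s / 2))) 0)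
    (fun j hj => mul_nonneg (Real.rpow_nonneg (hpos j hj).le _) (le_max_right _ _)) hsum A B
  rw [hT, sum_Ioc_eq_mul hAB (c := m ^ (-(s / 2)) * max (1 - κ * m ^ (-(s / 2))) 0)
    (fun j h1 h2 => by simp only [hblock j h1 h2])] at hle
  have hw : 0 < m ^ (-(s / 2)) := Real.rpow_pos_of_pos hm _
  have hww := rpow_mul_rpow_neg_half_sq hm s
  set w := m ^ (-(s / 2))
  have hBA : (0 : ℝ) ≤ (B : ℝ) - A := sub_nonneg.2 (by exact_mod_cast hAB)
  have h1 : w * (((B : ℝ) - A) * (1 - κ * w)) ≤ w * (κ * w * (R * n * m ^ s / σ ^ 2)) := by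
    calc w * (((B : ℝ) - A) * (1 - κ * w))
        ≤ w * (((B : ℝ) - A) * max (1 - κ * w) 0) := by gcongr; exact le_max_left _ _
      _ = ((B : ℝ) - A) * (w * max (1 - κ * w) 0) := by ring
      _ ≤ R * n * κ / σ ^ 2 := hle
      _ = R * n * κ / σ ^ 2 * (m ^ s * (w * w)) := by rw [hww, mul_one]
      _ = w * (κ * w * (R * n * m ^ s / σ ^ 2)) := by ring
  exact le_of_mul_le_mul_left h1 hw

/-- When the positive parts vanish beyond the block `(A, B]`, the Pinsker equation reduces to
that block up to an error of at most `A`. -/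
theorem exists_pinskerLHS_remainder (hs : 0 < s) (hσ : 0 < σ) (hn : 0 < n) (hκ : 0 < κ)
    (hm : 0 < m) (hpos : ∀ j, 1 ≤ j → 0 < lam j)
    (hanti : ∀ i j, 1 ≤ i → i ≤ j → lam j ≤ lam i) (hAB : A < B)
    (hblock : ∀ j, A < j → j ≤ B → lam j = m)
    (htail : ∀ j, B < j → 1 ≤ κ * lam j ^ (-(s / 2))) (h : pinskerLHS s σ n lam κ = R) :
    ∃ E : ℝ, 0 ≤ E ∧ E ≤ A ∧ κ * m ^ (-(s / 2)) * (R * n * m ^ s / σ ^ 2) =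
      E + ((B : ℝ) - A) * max (1 - κ * m ^ (-(s / 2))) 0 := by
  have hT := tsum_eq_of_pinskerLHS_eq hσ hn hκ h
  rw [tsum_eq_sum_Ioc_of_forall_gt (B := B)
    (f := fun j => lam j ^ (-(s / 2)) * max (1 - κ * lam j ^ (-(s / 2))) 0)
    (fun j hj => by
      rw [max_eq_right (by linarith [htail j hj]), mul_zero]),
    ← Finset.sum_Ioc_consecutive _ (Nat.zero_le A) hAB.le,
    sum_Ioc_eq_mul hAB.le (c := m ^ (-(s / 2)) * max (1 - κ * m ^ (-(s / 2))) 0)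
    (fun j h1 h2 => by simp only [hblock j h1 h2])] at hT
  have hw : 0 < m ^ (-(s / 2)) := Real.rpow_pos_of_pos hm _
  have hww := rpow_mul_rpow_neg_half_sq hm s
  have hhead : ∀ j ∈ Finset.Ioc 0 A,
      0 ≤ lam j ^ (-(s / 2)) ∧ lam j ^ (-(s / 2)) ≤ m ^ (-(s / 2)) := by
    intro j hj
    rw [Finset.mem_Ioc] at hj
    refine ⟨Real.rpow_nonneg (hpos j hj.1).le _, ?_⟩
    refine Real.rpow_le_rpow_of_nonpos hm ?_ (by linarith)
    rw [← hblock B hAB le_rfl]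
    exact hanti j B hj.1 (by omega)
  set w := m ^ (-(s / 2))
  set S := ∑ j ∈ Finset.Ioc 0 A, lam j ^ (-(s / 2)) * max (1 - κ * lam j ^ (-(s / 2))) 0
  refine ⟨S / w, ?_, ?_, ?_⟩
  · refine div_nonneg (Finset.sum_nonneg fun j hj => ?_) hw.le
    exact mul_nonneg (hhead j hj).1 (le_max_right _ _)
  · rw [div_le_iff₀ hw]
    calc S ≤ ∑ j ∈ Finset.Ioc 0 A, w := Finset.sum_le_sum fun j hj => by
          obtain ⟨h0, h1⟩ := hhead j hj
          have h2 : max (1 - κ * lam j ^ (-(s / 2))) 0 ≤ 1 :=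
            max_le (by nlinarith) zero_le_one
          calc _ ≤ lam j ^ (-(s / 2)) * 1 := by gcongr
            _ ≤ w := by rw [mul_one]; exact h1
      _ = A * w := by simp
  · have h1 : κ * w * (R * n * m ^ s / σ ^ 2) = R * n * κ / σ ^ 2 * (m ^ s * (w * w)) / w := by
      field_simp
    rw [h1, hww, mul_one, ← hT]
    field_simp

/-- `D*` is carried by the block `(A, B]` up to an error of at most `σ² A / n`. -/
theorem exists_pinskerD_remainder (hκ : 0 < κ)
    (hpos : ∀ j, 1 ≤ j → 0 < lam j) (hAB : A < B)
    (hblock : ∀ j, A < j → j ≤ B → lam j = m)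
    (htail : ∀ j, B < j → 1 ≤ κ * lam j ^ (-(s / 2))) (hx : κ * m ^ (-(s / 2)) < 1) :
    ∃ E : ℝ, 0 ≤ E ∧ E ≤ A ∧
      pinskerD s σ n lam κ = σ ^ 2 / n * (E + ((B : ℝ) - A) * (1 - κ * m ^ (-(s / 2)))) := by
  have hiff : ∀ j, 1 ≤ j → (κ < lam j ^ (s / 2) ↔ κ * lam j ^ (-(s / 2)) < 1) := by
    intro j hj
    rw [Real.rpow_neg (hpos j hj).le, ← div_eq_mul_inv,
      div_lt_one (Real.rpow_pos_of_pos (hpos j hj) _)]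
  have hN : blockN s lam κ = B := by
    refine IsGreatest.csSup_eq ⟨⟨by omega, ?_⟩, ?_⟩
    · rw [hiff B (by omega), hblock B hAB le_rfl]
      exact hx
    · rintro j ⟨hj1, hj⟩
      rw [hiff j hj1] at hj
      by_contra hlt
      linarith [htail j (not_le.1 hlt)]
  refine ⟨∑ j ∈ Finset.Ioc 0 A, pinskerEll s lam κ j,
    Finset.sum_nonneg fun j _ => le_max_right _ _, ?_, ?_⟩
  · calc _ ≤ ∑ j ∈ Finset.Ioc 0 A, (1 : ℝ) := Finset.sum_le_sum fun j hj => by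
          have := Real.rpow_nonneg (hpos j (Finset.mem_Ioc.1 hj).1).le (-(s / 2))
          exact max_le (by nlinarith) zero_le_one
      _ = A := by simp
  · have hIcc : Finset.Icc 1 B = Finset.Ioc 0 B := rfl
    rw [pinskerD, hN, hIcc, ← Finset.sum_Ioc_consecutive _ (Nat.zero_le A) hAB.le,
      sum_Ioc_eq_mul hAB.le (c := 1 - κ * m ^ (-(s / 2)))]
    intro j h1 h2
    rw [pinskerEll, hblock j h1 h2, max_eq_left (by linarith)]

end Block

/-- If `p ≥ 1` and `γ = p(s+1)` (so `γ − p = ps`) then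
`d^{ps} · D*(d) → σ² / (α p! + σ²/(R a_p^s (p!)^s))`. -/
theorem statement12
    (s R σ α γ : ℝ) (hs : 0 < s) (hR : 0 < R) (hσ : 0 < σ) (hα : 0 < α) (hγ : 0 < γ)
    (p : ℕ) (hp : p = ⌊γ / (s + 1)⌋₊)
    (a : ℕ → ℝ) (ha : ∀ k ≤ p + 3, 0 < a k)
    (n : ℕ → ℕ) (hn : ∀ d, 0 < n d)
    (hnlim : Tendsto (fun d : ℕ => (n d : ℝ) / (d : ℝ) ^ γ) atTop (nhds α))
    (μ : ℕ → ℕ → ℝ)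
    (hμlim : ∀ k ≤ p + 3, Tendsto (fun d : ℕ => (d : ℝ) ^ k * μ d k) atTop
      (nhds (a k * Nat.factorial k)))
    (hμorder : ∀ᶠ d in atTop, (∀ k < p + 2, μ d (k + 1) < μ d k) ∧ 0 < μ d (p + 2))
    (lam : ℕ → ℕ → ℝ)
    (hlampos : ∀ d j, 1 ≤ j → 0 < lam d j)
    (hlamanti : ∀ d i j, 1 ≤ i → i ≤ j → lam d j ≤ lam d i)
    (hlamlim : ∀ d, Tendsto (lam d) atTop (nhds 0))
    (hblock : ∀ᶠ d in atTop, ∀ k ≤ p + 2, ∀ j : ℕ,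
      vprev d k < (j : ℝ) → (j : ℝ) ≤ vdim d k → lam d j = μ d k)
    (κstar : ℕ → ℝ)
    (hκ : ∀ d, 0 < κstar d ∧ pinskerLHS s σ (n d) (lam d) (κstar d) = R)
    (hp1 : 1 ≤ p) (hγeq : γ = (p : ℝ) * (s + 1)) :
    Tendsto (fun d : ℕ => (d : ℝ) ^ ((p : ℝ) * s) * pinskerD s σ (n d) (lam d) (κstar d))
      atTop (nhds (σ ^ 2 /
        (α * Nat.factorial p + σ ^ 2 / (R * a p ^ s * (Nat.factorial p : ℝ) ^ s)))) := by
  have hp2 : p ≤ p + 3 := by omega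
  have hpnat : ∀ᶠ d : ℕ in atTop, 0 < d := eventually_gt_atTop 0
  have hap : 0 < a p := ha p hp2
  have hfac : (0 : ℝ) < (p.factorial : ℝ) := by positivity
  -- Block endpoints.
  obtain ⟨A, hA⟩ : ∃ A : ℕ → ℕ, ∀ d, A d = ⌊vprev d p⌋₊ := ⟨_, fun _ => rfl⟩
  obtain ⟨B, hB⟩ : ∃ B : ℕ → ℕ, ∀ d, B d = ⌊vdim d p⌋₊ := ⟨_, fun _ => rfl⟩
  have hvdim0 : ∀ d, 0 < d → 0 ≤ vdim d p := fun d hd => vprev_nonneg hd (p + 1)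
  have hAlim : Tendsto (fun d : ℕ => (A d : ℝ) / (d : ℝ) ^ p) atTop (nhds 0) := by
    simp only [hA]
    exact tendsto_floor_div_pow hp1 (hpnat.mono fun d hd => vprev_nonneg hd p)
      (tendsto_vprev_div_pow p)
  have hBlim : Tendsto (fun d : ℕ => (B d : ℝ) / (d : ℝ) ^ p) atTop
      (nhds (1 / p.factorial)) := by
    simp only [hB]
    exact tendsto_floor_div_pow hp1 (hpnat.mono hvdim0) (tendsto_vdim_div_pow p)
  obtain ⟨b, hb⟩ : ∃ b : ℕ → ℝ, ∀ d, b d = ((B d : ℝ) - A d) / (d : ℝ) ^ p :=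
    ⟨_, fun _ => rfl⟩
  have hblim : Tendsto b atTop (nhds (1 / p.factorial)) := by
    have := hBlim.sub hAlim
    rw [sub_zero] at this
    exact this.congr fun d => by rw [hb, sub_div]
  have hbpos : ∀ᶠ d in atTop, 0 < b d := hblim.eventually_const_lt (by positivity)
  have hABlt : ∀ᶠ d in atTop, A d < B d := by
    filter_upwards [hbpos] with d h
    by_contra hle
    have h1 : (B d : ℝ) ≤ A d := by exact_mod_cast not_lt.1 hle
    rw [hb] at h
    exact absurd h (not_lt.2 (div_nonpos_of_nonpos_of_nonneg (by linarith) (by positivity)))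
  have hμpos : ∀ k ≤ p + 3, ∀ᶠ d in atTop, 0 < μ d k := by
    intro k hk
    have h1 : 0 < a k * (k.factorial : ℝ) := mul_pos (ha k hk) (by positivity)
    filter_upwards [(hμlim k hk).eventually_const_lt h1] with d hd
    exact pos_of_mul_pos_right hd (by positivity)
  have hlamB : ∀ᶠ d in atTop, ∀ j, A d < j → j ≤ B d → lam d j = μ d p := by
    filter_upwards [hblock, hpnat] with d hd hd0 j h1 h2
    rw [hA] at h1
    rw [hB] at h2
    exact hd p (by omega) j (Nat.lt_of_floor_lt h1) ((Nat.le_floor_iff (hvdim0 d hd0)).1 h2)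
  have hlamB1 : ∀ᶠ d in atTop, lam d (B d + 1) = μ d (p + 1) := by
    filter_upwards [hblock, hpnat,
      (tendsto_sphDim_atTop (k := p + 1) (by omega)).eventually_ge_atTop 1] with d hd hd0 h1
    refine hd (p + 1) (by omega) _ ?_ ?_
    · have := Nat.lt_floor_add_one (vdim d p)
      rw [hB]
      exact_mod_cast this
    · have h2 := Nat.floor_le (hvdim0 d hd0)
      have h3 : vprev d (p + 1) = vdim d p := rfl
      rw [vdim_eq_vprev_add, h3, hB]
      push_cast
      linarith
  -- The rescaled constants.
  obtain ⟨x, hx⟩ : ∃ x : ℕ → ℝ, ∀ d, x d = κstar d * μ d p ^ (-(s / 2)) := ⟨_, fun _ => rfl⟩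
  obtain ⟨r, hr⟩ : ∃ r : ℕ → ℝ, ∀ d, r d = R * n d * μ d p ^ s / σ ^ 2 / (d : ℝ) ^ p :=
    ⟨_, fun _ => rfl⟩
  have hdγ : ∀ d : ℕ, 0 < d → (d : ℝ) ^ γ = ((d : ℝ) ^ p) ^ s * (d : ℝ) ^ p := by
    intro d hd
    have hd' : (0 : ℝ) < d := by positivity
    rw [hγeq, mul_add, mul_one, Real.rpow_add hd', Real.rpow_natCast, Real.rpow_mul hd'.le,
      Real.rpow_natCast]
  obtain ⟨ρ, hρ⟩ : ∃ ρ : ℝ, ρ = R / σ ^ 2 * (α * (a p * p.factorial) ^ s) := ⟨_, rfl⟩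
  have hρ0 : 0 < ρ := by rw [hρ]; positivity
  have hrlim : Tendsto r atTop (nhds ρ) := by
    have h1 := (hnlim.mul ((hμlim p hp2).rpow_const (p := s)
      (Or.inr hs.le))).const_mul (R / σ ^ 2)
    rw [← hρ] at h1
    refine h1.congr' ?_
    filter_upwards [hpnat, hμpos p hp2] with d hd hm
    have hd' : (0 : ℝ) < (d : ℝ) ^ p := by positivity
    have hds : (0 : ℝ) < ((d : ℝ) ^ p) ^ s := Real.rpow_pos_of_pos hd' _
    rw [hr, hdγ d hd, Real.mul_rpow hd'.le hm.le]
    field_simp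
  have hrpos : ∀ᶠ d in atTop, 0 < r d := hrlim.eventually_const_lt hρ0
  have hxlow : ∀ᶠ d in atTop, b d / (r d + b d) ≤ x d := by
    filter_upwards [hpnat, hμpos p hp2, hABlt, hlamB, hbpos, hrpos] with d hd hm hAB hl hb0 hr0
    have h := block_le_of_pinskerLHS_eq hσ (hn d) (hκ d).1 hR hm (hlampos d) hAB.le hl (hκ d).2
    rw [← hx] at h
    have hd' : (0 : ℝ) < (d : ℝ) ^ p := by positivity
    have h2 := div_le_div_of_nonneg_right h hd'.le
    rw [mul_div_right_comm, mul_div_assoc, ← hb, ← hr] at h2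
    rw [div_le_iff₀ (by positivity)]
    linarith
  have hlowlim : Tendsto (fun d => b d / (r d + b d)) atTop
      (nhds (1 / p.factorial / (ρ + 1 / p.factorial))) :=
    hblim.div (hrlim.add hblim) (by positivity)
  obtain ⟨c, hc0, hc⟩ := exists_between
    (show (0 : ℝ) < 1 / p.factorial / (ρ + 1 / p.factorial) by positivity)
  have hxc : ∀ᶠ d in atTop, c ≤ x d := by
    filter_upwards [hxlow, hlowlim.eventually_const_lt hc] with d h1 h2
    linarith
  -- The blocks above degree `p` do not contribute.
  have hratio : Tendsto (fun d => (μ d p / μ d (p + 1)) ^ (s / 2)) atTop atTop := by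
    refine (tendsto_rpow_atTop (by positivity : 0 < s / 2)).comp ?_
    have h1 := ((hμlim p hp2).div (hμlim (p + 1) (by omega))
      (mul_pos (ha (p + 1) (by omega)) (by positivity)).ne').pos_mul_atTop
      (div_pos (by positivity) (mul_pos (ha (p + 1) (by omega)) (by positivity)))
      (tendsto_natCast_atTop_atTop (R := ℝ))
    refine h1.congr' ?_
    filter_upwards [hpnat, hμpos (p + 1) (by omega)] with d hd hm
    have hd' : (0 : ℝ) < d := by positivity
    rw [Pi.div_apply]
    field_simp
    ring
  have htail : ∀ᶠ d in atTop, ∀ j, B d < j → 1 ≤ κstar d * lam d j ^ (-(s / 2)) := by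
    filter_upwards [hxc, hratio.eventually_ge_atTop (1 / c), hμpos p hp2,
      hμpos (p + 1) (by omega), hlamB1] with d h1 h2 hm hm1 hl j hj
    have h3 : lam d j ≤ μ d (p + 1) := by
      rw [← hl]
      exact hlamanti d _ _ (by omega) (by omega)
    have h4 : μ d (p + 1) ^ (-(s / 2)) ≤ lam d j ^ (-(s / 2)) :=
      Real.rpow_le_rpow_of_nonpos (hlampos d j (by omega)) h3 (by linarith)
    calc (1 : ℝ) = c * (1 / c) := by field_simp
      _ ≤ x d * (μ d p / μ d (p + 1)) ^ (s / 2) := mul_le_mul h1 h2 (by positivity) (hc0.le.trans h1)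
      _ = κstar d * μ d (p + 1) ^ (-(s / 2)) := by
        have h5 : 0 < μ d p ^ (s / 2) := Real.rpow_pos_of_pos hm _
        rw [hx, Real.div_rpow hm.le hm1.le, Real.rpow_neg hm.le, Real.rpow_neg hm1.le]
        field_simp
      _ ≤ κstar d * lam d j ^ (-(s / 2)) := by
        have := (hκ d).1
        gcongr
  have hrem : ∀ᶠ d in atTop, ∃ e, 0 ≤ e ∧ e ≤ (A d : ℝ) / (d : ℝ) ^ p ∧
      x d * r d = e + b d * max (1 - x d) 0 := by
    filter_upwards [hpnat, hμpos p hp2, hABlt, hlamB, htail] with d hd hm hAB hl ht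
    obtain ⟨E, h0, h1, h2⟩ := exists_pinskerLHS_remainder hs hσ (hn d) (hκ d).1 hm (hlampos d)
      (hlamanti d) hAB hl ht (hκ d).2
    have hd' : (0 : ℝ) < (d : ℝ) ^ p := by positivity
    refine ⟨E / (d : ℝ) ^ p, by positivity, by gcongr, ?_⟩
    rw [← hx] at h2
    rw [hr, hb, ← mul_div_assoc, h2]
    ring
  have hx1 : ∀ᶠ d in atTop, x d < 1 := by
    have h1 : Tendsto (fun d => c * r d - (A d : ℝ) / (d : ℝ) ^ p) atTop (nhds (c * ρ - 0)) :=
      (hrlim.const_mul c).sub hAlim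
    have h2 : 0 < c * ρ - 0 := by rw [sub_zero]; positivity
    filter_upwards [hrem, hxc, hrpos, h1.eventually_const_lt h2] with d ⟨e, _, he, h⟩ h3 h4 h5
    by_contra hge
    rw [max_eq_right (by linarith [not_lt.1 hge])] at h
    have := mul_le_mul_of_nonneg_right h3 h4.le
    linarith
  have hxlim : Tendsto x atTop (nhds (1 / p.factorial / (ρ + 1 / p.factorial))) := by
    have hup : Tendsto (fun d => ((A d : ℝ) / (d : ℝ) ^ p + b d) / (r d + b d)) atTop
        (nhds ((0 + 1 / p.factorial) / (ρ + 1 / p.factorial))) :=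
      (hAlim.add hblim).div (hrlim.add hblim) (by positivity)
    rw [zero_add] at hup
    refine tendsto_of_tendsto_of_tendsto_of_le_of_le' hlowlim hup hxlow ?_
    filter_upwards [hrem, hx1, hrpos, hbpos] with d ⟨e, _, he, h⟩ h3 h4 h5
    rw [max_eq_left (by linarith)] at h
    rw [le_div_iff₀ (by positivity)]
    linarith
  -- The limit of `D*`.
  have hbx := hblim.mul (hxlim.const_sub 1)
  have hnl := (hnlim.inv₀ hα.ne').const_mul (σ ^ 2)
  have hD : ∀ᶠ d in atTop, ∃ e, 0 ≤ e ∧ e ≤ (A d : ℝ) / (d : ℝ) ^ p ∧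
      (d : ℝ) ^ ((p : ℝ) * s) * pinskerD s σ (n d) (lam d) (κstar d) =
        σ ^ 2 * ((n d : ℝ) / (d : ℝ) ^ γ)⁻¹ * (e + b d * (1 - x d)) := by
    filter_upwards [hpnat, hABlt, hlamB, htail, hx1] with d hd hAB hl ht h1
    rw [hx] at h1
    obtain ⟨E, h2, h3, h4⟩ := exists_pinskerD_remainder (σ := σ) (n := n d) (hκ d).1 (hlampos d)
      hAB hl ht h1
    have hd' : (0 : ℝ) < (d : ℝ) ^ p := by positivity
    refine ⟨E / (d : ℝ) ^ p, by positivity, by gcongr, ?_⟩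
    rw [← hx] at h4
    rw [h4, hb, hdγ d hd, Real.rpow_mul (Nat.cast_nonneg d), Real.rpow_natCast]
    have hn' : (n d : ℝ) ≠ 0 := by exact_mod_cast (hn d).ne'
    field_simp
  have hlower := hnl.mul hbx
  have hupper := hnl.mul (hAlim.add hbx)
  rw [zero_add] at hupper
  have hval : σ ^ 2 * α⁻¹ * (1 / p.factorial * (1 - 1 / p.factorial / (ρ + 1 / p.factorial))) =
      σ ^ 2 / (α * p.factorial + σ ^ 2 / (R * a p ^ s * (p.factorial : ℝ) ^ s)) := by
    have hQ : (0 : ℝ) < a p ^ s := Real.rpow_pos_of_pos hap _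
    have hQ' : (0 : ℝ) < (p.factorial : ℝ) ^ s := Real.rpow_pos_of_pos hfac _
    have h1 : ρ = R / σ ^ 2 * (α * (a p ^ s * (p.factorial : ℝ) ^ s)) := by
      rw [hρ, Real.mul_rpow hap.le hfac.le]
    have h2 : 1 - 1 / (p.factorial : ℝ) / (ρ + 1 / p.factorial) =
        ρ * p.factorial / (ρ * p.factorial + 1) := by
      field_simp
      ring
    rw [h2, h1]
    field_simp
  rw [hval] at hlower hupper
  refine tendsto_of_tendsto_of_tendsto_of_le_of_le' hlower hupper ?_ ?_
  · filter_upwards [hD] with d ⟨e, h0, _, h⟩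
    rw [h]
    gcongr
    linarith
  · filter_upwards [hD] with d ⟨e, _, h0, h⟩
    rw [h]
    gcongr
end
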